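/- arXiv:math/0610878 — 3 statements merged into one kernel-verified Lean document; each statement's English description precedes it below -/
import Mathlib

section
/- Zero-dimensionality from zero-dimensional tropicalization: Let K be an algebraically closed field equipped with a surjective group homomorphism v : Kˣ → (ℚ, +) satisfying v(x + y) ≥ min(v(x), v(y)) whenever x, y, x + y ∈ Kˣ. Let X ⊆ (Kˣ)^n be the common zero set of a collection of Laurent polynomials in n variables over K. If the image v(X) = { (v(x₁), …, v(x_n)) : x ∈ X } ⊆ ℚ^n is finite, then X is a finite set. -/
open Polynomial in
theorem aux_point {K A : Type*} [Field K] [IsAlgClosed K] [CommRing A] [Algebra K A]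
    [Algebra.FiniteType K A] (t : A) (ht : Transcendental K t) :
    ∃ f : K[X], f ≠ 0 ∧ ∀ a : K, f.eval a ≠ 0 → ∃ φ : A →ₐ[K] K, φ t = a := by
  let g : K[X] →+* A := (aeval (R := K) t).toRingHom
  have hg : Function.Injective g := transcendental_iff_injective.mp ht
  have hfp : g.FinitePresentation := by
    rw [← RingHom.FinitePresentation.of_finiteType]
    refine RingHom.FiniteType.of_comp_finiteType (f := algebraMap K K[X]) ?_
    have : g.comp (algebraMap K K[X]) = algebraMap K A := (aeval (R := K) t).comp_algebraMap
    rw [this, RingHom.finiteType_algebraMap]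
    infer_instance
  obtain ⟨S, hS⟩ := PrimeSpectrum.exists_constructibleSetData_iff.mpr
    (PrimeSpectrum.isConstructible_range_comap hfp)
  obtain ⟨p, hp, hpe⟩ := Ideal.exists_comap_eq_of_mem_minimalPrimes_of_injective hg ⊥
    (by rw [IsDomain.minimalPrimes_eq_singleton_bot]; rfl)
  have hmem : (⊥ : PrimeSpectrum K[X]) ∈ S.toSet := by
    rw [hS]
    exact ⟨⟨p, hp⟩, PrimeSpectrum.ext hpe⟩
  simp only [PrimeSpectrum.ConstructibleSetData.toSet, Set.mem_iUnion] at hmem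
  obtain ⟨C, hC, hg0, hf0⟩ := hmem
  have hf : C.f ≠ 0 := by
    intro h
    apply hf0
    simp [PrimeSpectrum.mem_zeroLocus, h]
  have hgz : ∀ i, C.g i = 0 := by
    intro i
    have : C.g i ∈ (⊥ : PrimeSpectrum K[X]).asIdeal := hg0 ⟨i, rfl⟩
    simpa using this
  refine ⟨C.f, hf, fun a ha => ?_⟩
  have hprime : (Ideal.span {X - Polynomial.C a} : Ideal K[X]).IsPrime := by
    rw [Ideal.span_singleton_prime (X_sub_C_ne_zero a)]
    exact prime_X_sub_C a
  have hmem : (⟨_, hprime⟩ : PrimeSpectrum K[X]) ∈ S.toSet := by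
    simp only [PrimeSpectrum.ConstructibleSetData.toSet, Set.mem_iUnion]
    refine ⟨C, hC, ?_, ?_⟩
    · rw [PrimeSpectrum.mem_zeroLocus]
      rintro _ ⟨i, rfl⟩
      simp [hgz]
    · rw [PrimeSpectrum.mem_zeroLocus, Set.singleton_subset_iff]
      intro h
      exact ha (dvd_iff_isRoot.mp (Ideal.mem_span_singleton.mp h))
  rw [hS] at hmem
  obtain ⟨q, hq⟩ := hmem
  obtain ⟨m, hm, hqm⟩ := Ideal.exists_le_maximal q.asIdeal q.2.ne_top
  have htm : t - algebraMap K A a ∈ m := by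
    apply hqm
    have : (X - Polynomial.C a : K[X]) ∈ (PrimeSpectrum.comap g q).asIdeal := by
      rw [hq]; exact Ideal.mem_span_singleton_self _
    simpa [g] using this
  let _ : Field (A ⧸ m) := Ideal.Quotient.field m
  have : Module.Finite K (A ⧸ m) := finite_of_finite_type_of_isJacobsonRing K (A ⧸ m)
  have hb : Function.Bijective (algebraMap K (A ⧸ m)) :=
    IsAlgClosed.algebraMap_bijective_of_isIntegral
  let e : K ≃ₐ[K] (A ⧸ m) := AlgEquiv.ofBijective (Algebra.ofId K (A ⧸ m)) hb
  refine ⟨(e.symm : (A ⧸ m) →ₐ[K] K).comp (Ideal.Quotient.mkₐ K m), ?_⟩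
  have h2 : Ideal.Quotient.mkₐ K m t = e a := by
    change Ideal.Quotient.mk m t = Ideal.Quotient.mk m (algebraMap K A a)
    exact Ideal.Quotient.eq.mpr htm
  simp [AlgHom.comp_apply, h2]

/-- **Zero-dimensionality from zero-dimensional tropicalization.** Let `K` be an algebraically
closed field with a surjective valuation `v : Kˣ → ℚ` (written additively) satisfying the
ultrametric inequality. Let `X ⊆ (Kˣ)^n` be the common zero set of a collection of Laurent
polynomials. If the image `v(X) ⊆ ℚ^n` is finite, then `X` is finite. -/
theorem finite_of_finite_tropicalization
    (K : Type*) [Field K] [IsAlgClosed K]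
    (v : Kˣ → ℚ)
    (hv_mul : ∀ x y : Kˣ, v (x * y) = v x + v y)
    (hv_surj : Function.Surjective v)
    (hv_ultra : ∀ x y z : Kˣ, (x : K) + (y : K) = (z : K) → min (v x) (v y) ≤ v z)
    (n : ℕ) (F : Set ((Fin n → ℤ) →₀ K))
    (X : Set (Fin n → Kˣ))
    (hX : X = {x | ∀ f ∈ F, ∑ a ∈ f.support, f a * ∏ i, (x i : K) ^ a i = 0})
    (hfin : ((fun x : Fin n → Kˣ => fun i => v (x i)) '' X).Finite) :
    X.Finite := by
  classical
  let L := AddMonoidAlgebra K (Fin n → ℤ)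
  let I : Ideal L := Ideal.span ((fun f => AddMonoidAlgebra.ofCoeff f) '' F)
  let A := L ⧸ I
  have hft : Algebra.FiniteType K L := by
    have : AddMonoid.FG (Fin n → ℤ) :=
      AddGroup.fg_iff_addMonoid_fg.mp (Module.Finite.iff_addGroup_fg.mp inferInstance)
    exact AddMonoidAlgebra.finiteType_of_fg K _
  have hftA : Algebra.FiniteType K A := inferInstance
  let T : Fin n → L := fun i => AddMonoidAlgebra.single (Pi.single i 1) 1
  let t : Fin n → A := fun i => Ideal.Quotient.mk I (T i)
  -- points give homs
  have hpt : ∀ x ∈ X, ∃ φ : A →ₐ[K] K, ∀ i, φ (t i) = x i := by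
    intro x hx
    let m : Multiplicative (Fin n → ℤ) →* K :=
      { toFun := fun a => ∏ i, (x i : K) ^ (a.toAdd i)
        map_one' := by simp
        map_mul' := by
          intro a b
          simp [← Finset.prod_mul_distrib, zpow_add₀] }
    let ψ : L →ₐ[K] K := AddMonoidAlgebra.lift K K (Fin n → ℤ) m
    have hker : ∀ a ∈ I, ψ a = 0 := by
      intro a ha
      have : I ≤ RingHom.ker ψ := by
        rw [Ideal.span_le]
        rintro _ ⟨f, hf, rfl⟩
        rw [hX] at hx
        have := hx f hf
        simp only [SetLike.mem_coe, RingHom.mem_ker, ψ, AddMonoidAlgebra.lift_apply]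
        exact this
      exact this ha
    refine ⟨Ideal.Quotient.liftₐ I ψ hker, fun i => ?_⟩
    change ψ (T i) = x i
    have h1 : ψ (T i) = (1 : K) • m (Multiplicative.ofAdd (Pi.single i 1)) :=
      AddMonoidAlgebra.lift_single _ _ _
    rw [h1, one_smul]
    change ∏ j, (x j : K) ^ ((Pi.single i 1 : Fin n → ℤ) j) = x i
    rw [Finset.prod_eq_single i]
    · simp
    · intro j _ hj
      simp [Pi.single_eq_of_ne hj]
    · simp
  -- homs give points
  have hhom : ∀ φ : A →ₐ[K] K, ∃ x ∈ X, ∀ i, φ (t i) = x i := by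
    intro φ
    let ψ : L →ₐ[K] K := φ.comp (Ideal.Quotient.mkₐ K I)
    let m : Multiplicative (Fin n → ℤ) →* Kˣ :=
      ((AddMonoidAlgebra.lift K K (Fin n → ℤ)).symm ψ).toHomUnits
    have hm : ∀ a, ((m (Multiplicative.ofAdd a) : Kˣ) : K) = ψ (AddMonoidAlgebra.single a 1) :=
      fun a => rfl
    let x : Fin n → Kˣ := fun i => m (Multiplicative.ofAdd (Pi.single i 1))
    have hprod : ∀ a : Fin n → ℤ, m (Multiplicative.ofAdd a) = ∏ i, x i ^ a i := by
      intro a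
      have : a = ∑ i, a i • (Pi.single i 1 : Fin n → ℤ) := by
        ext j
        simp [Finset.sum_apply, Pi.single_apply]
      conv_lhs => rw [this]
      rw [ofAdd_sum, map_prod]
      simp only [ofAdd_zsmul, map_zpow, x]
    refine ⟨x, ?_, fun i => rfl⟩
    rw [hX]
    intro f hf
    have h0 : ψ (AddMonoidAlgebra.ofCoeff f) = 0 := by
      have : Ideal.Quotient.mk I (AddMonoidAlgebra.ofCoeff f) = 0 :=
        Ideal.Quotient.eq_zero_iff_mem.mpr (Ideal.subset_span ⟨f, hf, rfl⟩)
      change φ (Ideal.Quotient.mk I _) = 0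
      rw [this, map_zero]
    rw [AddMonoidAlgebra.lift_unique ψ] at h0
    rw [← h0]
    refine Finset.sum_congr rfl fun a _ => ?_
    change f a * _ = f a • _
    rw [← hm, hprod, smul_eq_mul]
    simp
  -- each coordinate is finite
  have halg : ∀ i, IsAlgebraic K (t i) := by
    intro i
    by_contra htr
    obtain ⟨f, hf, hfa⟩ := aux_point (t i) htr
    have hfS : ((fun w : Fin n → ℚ => w i) '' ((fun x : Fin n → Kˣ => fun i => v (x i)) '' X)
        ∪ v '' {u : Kˣ | (u : K) ∈ f.rootSet K}).Finite := by
      refine (hfin.image _).union (Set.Finite.image _ ?_)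
      exact Set.Finite.preimage Units.val_injective.injOn (f.rootSet_finite K)
    obtain ⟨r, hr⟩ := hfS.infinite_compl.nonempty
    obtain ⟨u, rfl⟩ := hv_surj r
    apply hr
    by_cases h : f.eval (u : K) = 0
    · right
      exact ⟨u, by simpa [Polynomial.mem_rootSet, hf] using h, rfl⟩
    · left
      obtain ⟨φ, hφ⟩ := hfa u h
      obtain ⟨x, hx, hxi⟩ := hhom φ
      refine ⟨_, ⟨x, hx, rfl⟩, ?_⟩
      have : x i = u := Units.ext ((hxi i).symm.trans hφ)
      simp [this]
  choose p hp hp0 using halg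
  refine Set.Finite.subset (Set.Finite.pi' (t := fun i => {u : Kˣ | (u : K) ∈ (p i).rootSet K})
    fun i => Set.Finite.preimage Units.val_injective.injOn ((p i).rootSet_finite K)) ?_
  intro x hx i
  obtain ⟨φ, hφ⟩ := hpt x hx
  have h1 : Polynomial.aeval (φ (t i)) (p i) = 0 := by
    rw [Polynomial.aeval_algHom_apply, hp0, map_zero]
  rw [hφ] at h1
  exact Polynomial.mem_rootSet.mpr ⟨hp i, h1⟩
end

section
/- Proper intersection from transverse tropicalizations: Let K be an algebraically closed field equipped with a surjective group homomorphism v : Kˣ → (ℚ, +) satisfying v(x + y) ≥ min(v(x), v(y)) whenever x, y, x + y ∈ Kˣ. Let V, W ⊆ (Kˣ)^n each be the common zero set of a collection of Laurent polynomials in n variables over K. If the intersection v(V) ∩ v(W) of their valuation images in ℚ^n is finite, then V ∩ W is a finite set. -/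
open Polynomial in
/-- A nontrivial finite type algebra over an algebraically closed field has a rational point. -/
lemma exists_algHom_of_finiteType (K : Type*) [Field K] [IsAlgClosed K]
    (A : Type*) [CommRing A] [Algebra K A] [Algebra.FiniteType K A] [Nontrivial A] :
    Nonempty (A →ₐ[K] K) := by
  obtain ⟨m, hm⟩ := Ideal.exists_maximal A
  let := Ideal.Quotient.field m
  have := finite_of_finite_type_of_isJacobsonRing K (A ⧸ m)
  have hint : Algebra.IsAlgebraic K (A ⧸ m) := inferInstance
  exact ⟨(IsAlgClosed.lift (S := A ⧸ m) (M := K) (R := K)).comp (Ideal.Quotient.mkₐ K m)⟩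

open Polynomial in
/-- If `t` takes infinitely many values on the points of a finite type algebra, it takes all but
finitely many values. -/
lemma cofinite_values (K : Type*) [Field K] [IsAlgClosed K]
    (A : Type*) [CommRing A] [Algebra K A] [Algebra.FiniteType K A] (t : A)
    (hinf : (Set.range fun φ : A →ₐ[K] K => φ t).Infinite) :
    (Set.range fun φ : A →ₐ[K] K => φ t)ᶜ.Finite := by
  have hinj : Function.Injective (aeval t : K[X] →ₐ[K] A).toRingHom := by
    rw [injective_iff_map_eq_zero]
    intro p hp
    apply Polynomial.eq_zero_of_infinite_isRoot
    refine hinf.mono ?_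
    rintro _ ⟨φ, rfl⟩
    change p.eval (φ t) = 0
    have h1 : aeval t p = 0 := hp
    have h2 := congrArg φ h1
    rw [map_zero, ← Polynomial.aeval_algHom_apply] at h2
    simpa [Polynomial.aeval_def] using h2
  obtain ⟨P, hP, hPc⟩ := Ideal.exists_comap_eq_of_mem_minimalPrimes_of_injective hinj ⊥
    (by rw [IsDomain.minimalPrimes_eq_singleton_bot]; rfl)
  let B := A ⧸ P
  let g : K[X] →ₐ[K] B := (Ideal.Quotient.mkₐ K P).comp (aeval t)
  let : Algebra K[X] B := g.toRingHom.toAlgebra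
  have hst : IsScalarTower K K[X] B := IsScalarTower.of_algebraMap_eq' g.comp_algebraMap.symm
  have hginj : Function.Injective (algebraMap K[X] B) := by
    rw [injective_iff_map_eq_zero]
    intro p hp
    have h1 : Ideal.Quotient.mk P (aeval t p) = 0 := hp
    rw [Ideal.Quotient.eq_zero_iff_mem] at h1
    have h2 : p ∈ P.comap (aeval t : K[X] →ₐ[K] A).toRingHom := h1
    rw [hPc] at h2
    simpa using h2
  have hft : Algebra.FiniteType K[X] B := Algebra.FiniteType.of_restrictScalars_finiteType K K[X] B
  have hfp : Algebra.FinitePresentation K[X] B := Algebra.FinitePresentation.of_finiteType.mp hft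
  have hfs : FaithfulSMul K[X] B := (faithfulSMul_iff_algebraMap_injective K[X] B).mpr hginj
  have htf : Module.IsTorsionFree K[X] B := inferInstance
  have hflat : Module.Flat K[X] B := inferInstance
  have hopen := (PrimeSpectrum.isOpenMap_comap_of_hasGoingDown_of_finitePresentation
    (R := K[X]) (S := B)).isOpen_range
  obtain ⟨s, hs⟩ := (PrimeSpectrum.isClosed_iff_zeroLocus _).mp hopen.isClosed_compl
  have hgen : (⊥ : PrimeSpectrum K[X]) ∈ Set.range (PrimeSpectrum.comap (algebraMap K[X] B)) := by
    refine ⟨⟨⊥, Ideal.isPrime_bot⟩, ?_⟩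
    ext1
    exact Ideal.comap_bot_of_injective _ hginj
  obtain ⟨f, hfs', hf0⟩ : ∃ f ∈ s, f ≠ 0 := by
    by_contra! hcon
    have : (⊥ : PrimeSpectrum K[X]) ∈ PrimeSpectrum.zeroLocus s := by
      intro f hf
      rw [hcon f hf]
      exact zero_mem _
    rw [← hs] at this
    exact this hgen
  refine (Polynomial.finite_setOfPred_isRoot hf0).subset ?_
  intro a ha
  by_contra hroot
  apply ha
  have hprime : (Ideal.span {(X - C a : K[X])}).IsPrime :=
    (Ideal.span_singleton_prime (Polynomial.X_sub_C_ne_zero a)).mpr (Polynomial.prime_X_sub_C a)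
  have hmem : (⟨_, hprime⟩ : PrimeSpectrum K[X]) ∈
      Set.range (PrimeSpectrum.comap (algebraMap K[X] B)) := by
    by_contra hn
    have h1 : (⟨_, hprime⟩ : PrimeSpectrum K[X]) ∈ PrimeSpectrum.zeroLocus s := by
      rw [← hs]; exact hn
    have h2 := h1 hfs'
    exact hroot (Polynomial.dvd_iff_isRoot.mp (Ideal.mem_span_singleton.mp h2))
  obtain ⟨Q, hQ⟩ := hmem
  have hXQ : (X - C a : K[X]) ∈ (PrimeSpectrum.comap (algebraMap K[X] B) Q).asIdeal := by
    rw [hQ]; exact Ideal.mem_span_singleton_self _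
  have hQp := Q.isPrime
  obtain ⟨ψ⟩ := exists_algHom_of_finiteType K (B ⧸ Q.asIdeal)
  let χ : A →ₐ[K] K := (ψ.comp (Ideal.Quotient.mkₐ K Q.asIdeal)).comp (Ideal.Quotient.mkₐ K P)
  refine ⟨χ, ?_⟩
  have h3 : Ideal.Quotient.mk P (aeval t (X - C a)) ∈ Q.asIdeal := hXQ
  have h4 : χ (aeval t (X - C a)) = 0 := by
    change ψ (Ideal.Quotient.mk Q.asIdeal (Ideal.Quotient.mk P (aeval t (X - C a)))) = 0
    rw [Ideal.Quotient.eq_zero_iff_mem.mpr h3, map_zero]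
  rw [map_sub, aeval_X, aeval_C, map_sub, AlgHom.commutes] at h4
  exact sub_eq_zero.mp h4

/-- The monomial character attached to a point of the torus. -/
noncomputable def torusChar (K : Type*) [Field K] {n : ℕ} (x : Fin n → Kˣ) :
    Multiplicative (Fin n → ℤ) →* K where
  toFun a := ∏ i, (x i : K) ^ (a.toAdd i)
  map_one' := by simp
  map_mul' a b := by
    rw [← Finset.prod_mul_distrib]
    refine Finset.prod_congr rfl fun i _ => ?_
    rw [toAdd_mul, Pi.add_apply, zpow_add₀ (x i).ne_zero]

lemma torus_lift_apply (K : Type*) [Field K] {n : ℕ} (x : Fin n → Kˣ) (f : (Fin n → ℤ) →₀ K) :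
    AddMonoidAlgebra.lift K K (Fin n → ℤ) (torusChar K x) (AddMonoidAlgebra.ofCoeff f)
      = ∑ a ∈ f.support, f a * ∏ i, (x i : K) ^ a i := by
  rw [AddMonoidAlgebra.lift_apply]
  rfl

/-- Every point of the Laurent polynomial ring comes from a point of the torus. -/
lemma exists_torusChar (K : Type*) [Field K] {n : ℕ}
    (φ : AddMonoidAlgebra K (Fin n → ℤ) →ₐ[K] K) :
    ∃ x : Fin n → Kˣ, φ = AddMonoidAlgebra.lift K K (Fin n → ℤ) (torusChar K x) := by
  let c : Multiplicative (Fin n → ℤ) →* K := (AddMonoidAlgebra.lift K K (Fin n → ℤ)).symm φ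
  let d : Multiplicative (Fin n → ℤ) →* Kˣ := c.toHomUnits
  refine ⟨fun i => d (.ofAdd (Pi.single i 1)), ?_⟩
  rw [← Equiv.symm_apply_eq]
  refine MonoidHom.ext fun a => ?_
  change c a = ∏ i, ((d (.ofAdd (Pi.single i 1)) : Kˣ) : K) ^ (a.toAdd i)
  have ha : a = ∏ i, (Multiplicative.ofAdd (Pi.single i (1 : ℤ)) :
      Multiplicative (Fin n → ℤ)) ^ (a.toAdd i) := by
    apply Multiplicative.toAdd.injective
    rw [toAdd_prod]
    ext j
    simp [Finset.sum_apply, Pi.single_apply]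
  have hd : c a = (d a : K) := rfl
  rw [hd]
  conv_lhs => rw [ha, map_prod]
  push_cast
  simp

/-- **Proper intersection from transverse tropicalizations.** Let `K` be an algebraically closed
field with a surjective valuation `v : Kˣ → ℚ` satisfying the ultrametric inequality. Let
`V, W ⊆ (Kˣ)^n` each be the common zero set of a collection of Laurent polynomials. If the
intersection `v(V) ∩ v(W)` of the valuation images in `ℚ^n` is finite, then `V ∩ W` is finite. -/
theorem finite_inter_of_finite_tropical_inter
    (K : Type*) [Field K] [IsAlgClosed K]
    (v : Kˣ → ℚ)
    (hv_mul : ∀ x y : Kˣ, v (x * y) = v x + v y)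
    (hv_surj : Function.Surjective v)
    (hv_ultra : ∀ x y z : Kˣ, (x : K) + (y : K) = (z : K) → min (v x) (v y) ≤ v z)
    (n : ℕ) (F G : Set ((Fin n → ℤ) →₀ K))
    (V W : Set (Fin n → Kˣ))
    (hV : V = {x | ∀ f ∈ F, ∑ a ∈ f.support, f a * ∏ i, (x i : K) ^ a i = 0})
    (hW : W = {x | ∀ g ∈ G, ∑ a ∈ g.support, g a * ∏ i, (x i : K) ^ a i = 0})
    (hfin : (((fun x : Fin n → Kˣ => fun i => v (x i)) '' V)
              ∩ ((fun x : Fin n → Kˣ => fun i => v (x i)) '' W)).Finite) :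
    (V ∩ W).Finite := by
  classical
  let I : Ideal (AddMonoidAlgebra K (Fin n → ℤ)) :=
    Ideal.span (AddMonoidAlgebra.ofCoeff '' (F ∪ G))
  have hpt : ∀ x : Fin n → Kˣ, x ∈ V ∩ W ↔
      ∀ p ∈ I, AddMonoidAlgebra.lift K K (Fin n → ℤ) (torusChar K x) p = 0 := by
    intro x
    have h1 : (∀ p ∈ I, AddMonoidAlgebra.lift K K (Fin n → ℤ) (torusChar K x) p = 0) ↔
        I ≤ RingHom.ker (AddMonoidAlgebra.lift K K (Fin n → ℤ) (torusChar K x)) := Iff.rfl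
    rw [h1, Ideal.span_le, Set.image_subset_iff, Set.union_subset_iff, hV, hW]
    refine and_congr (forall₂_congr fun f _ => ?_) (forall₂_congr fun f _ => ?_) <;>
    · rw [← torus_lift_apply]
      rfl
  have hcoord : ∀ i : Fin n, ((fun x : Fin n → Kˣ => x i) '' (V ∩ W)).Finite := by
    intro i
    by_contra hnf
    have hvfin : (v '' ((fun x : Fin n → Kˣ => x i) '' (V ∩ W))).Finite := by
      refine (hfin.image fun q : Fin n → ℚ => q i).subset ?_
      rintro _ ⟨_, ⟨x, hx, rfl⟩, rfl⟩
      exact ⟨fun j => v (x j), ⟨⟨x, hx.1, rfl⟩, ⟨x, hx.2, rfl⟩⟩, rfl⟩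
    let t : AddMonoidAlgebra K (Fin n → ℤ) ⧸ I :=
      Ideal.Quotient.mk I (AddMonoidAlgebra.single (Pi.single i 1) 1)
    have hval : ∀ x : Fin n → Kˣ, AddMonoidAlgebra.lift K K (Fin n → ℤ) (torusChar K x)
        (AddMonoidAlgebra.single (Pi.single i 1) 1) = (x i : K) := by
      intro x
      rw [AddMonoidAlgebra.lift_single, one_smul]
      change ∏ j, (x j : K) ^ ((Pi.single i 1 : Fin n → ℤ) j) = _
      rw [Finset.prod_eq_single i]
      · simp
      · intro j _ hj
        simp [Pi.single_apply, hj]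
      · simp
    have hrange : (Set.range fun φ : (AddMonoidAlgebra K (Fin n → ℤ) ⧸ I) →ₐ[K] K => φ t)
        = Units.val '' ((fun x : Fin n → Kˣ => x i) '' (V ∩ W)) := by
      ext a
      constructor
      · rintro ⟨φ, rfl⟩
        obtain ⟨x, hx⟩ := exists_torusChar K (φ.comp (Ideal.Quotient.mkₐ K I))
        refine ⟨x i, ⟨x, (hpt x).mpr fun p hp => ?_, rfl⟩, ?_⟩
        · rw [← hx]
          change φ (Ideal.Quotient.mk I p) = 0
          rw [Ideal.Quotient.eq_zero_iff_mem.mpr hp, map_zero]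
        · rw [← hval x, ← hx]
          rfl
      · rintro ⟨_, ⟨x, hx, rfl⟩, rfl⟩
        refine ⟨Ideal.Quotient.liftₐ I _ ((hpt x).mp hx), ?_⟩
        exact hval x
    have hcof := cofinite_values K _ t (by
      rw [hrange]
      exact Set.Infinite.image Units.val_injective.injOn hnf)
    rw [hrange] at hcof
    have hC : (((fun x : Fin n → Kˣ => x i) '' (V ∩ W))ᶜ).Finite := by
      refine Set.Finite.of_finite_image (f := Units.val) (hcof.subset ?_) Units.val_injective.injOn
      rintro _ ⟨u, hu, rfl⟩ ⟨w, hw, hwu⟩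
      exact hu (Units.val_injective hwu ▸ hw)
    obtain ⟨q, hq⟩ := (hvfin.union (hC.image v)).exists_notMem
    obtain ⟨u, rfl⟩ := hv_surj q
    apply hq
    by_cases hu : u ∈ ((fun x : Fin n → Kˣ => x i) '' (V ∩ W))
    · exact Or.inl ⟨u, hu, rfl⟩
    · exact Or.inr ⟨u, hu, rfl⟩
  refine (Set.Finite.pi' hcoord).subset ?_
  intro x hx i
  exact ⟨x, hx, rfl⟩
end

section
/- Bernstein's bound (without multiplicities): Let f₁, …, f_n be nonzero Laurent polynomials in n variables over ℂ, and suppose their common zero set Z = { x ∈ (ℂˣ)^n : f₁(x) = ⋯ = f_n(x) = 0 } is finite. For each i let P_i ⊆ ℝ^n be the Newton polytope of f_i, the convex hull of the (finite) support of f_i in ℤ^n ⊆ ℝ^n. Then the cardinality of Z is at most the mixed volume MV(P₁, …, P_n) = Σ_{S ⊆ {1, …, n}} (−1)^{n − |S|} vol_n( Σ_{i ∈ S} P_i ), where Σ_{i ∈ S} P_i is the Minkowski sum of the polytopes P_i for i ∈ S (equal to {0} when S is empty) and vol_n is n-dimensional Lebesgue measure. -/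
open Pointwise MeasureTheory

namespace BKK
variable {n : ℕ}

/-- height of the exponent `a` in direction `w` -/
noncomputable def ht (ω : (Fin n → ℤ) → ℝ) (w : Fin n → ℝ) (a : Fin n → ℤ) : ℝ :=
  ω a + ∑ j, (a j : ℝ) * w j

open Classical in
/-- minimizers of the height -/
noncomputable def mins (A : Finset (Fin n → ℤ)) (ω : (Fin n → ℤ) → ℝ) (w : Fin n → ℝ) :
    Finset (Fin n → ℤ) := A.filter (fun a => ∀ b ∈ A, ht ω w a ≤ ht ω w b)

/-- the embedding of integer vectors into real vectors -/
def emb (a : Fin n → ℤ) : Fin n → ℝ := fun j => (a j : ℝ)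

/-- minimal height -/
noncomputable def mh (A : Finset (Fin n → ℤ)) (ω : (Fin n → ℤ) → ℝ) (w : Fin n → ℝ) : ℝ :=
  sInf (ht ω w '' (A : Set (Fin n → ℤ)))

lemma mem_mins {A : Finset (Fin n → ℤ)} {ω : (Fin n → ℤ) → ℝ} {w : Fin n → ℝ} {a : Fin n → ℤ} :
    a ∈ mins A ω w ↔ a ∈ A ∧ ∀ b ∈ A, ht ω w a ≤ ht ω w b := by
  classical
  simp [mins]

lemma mh_le {A : Finset (Fin n → ℤ)} {ω : (Fin n → ℤ) → ℝ} {w : Fin n → ℝ} {a : Fin n → ℤ}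
    (ha : a ∈ A) : mh A ω w ≤ ht ω w a :=
  csInf_le ((A.finite_toSet.image _).bddBelow) ⟨a, ha, rfl⟩

lemma mins_nonempty {A : Finset (Fin n → ℤ)} (hA : A.Nonempty) (ω : (Fin n → ℤ) → ℝ)
    (w : Fin n → ℝ) : (mins A ω w).Nonempty := by
  obtain ⟨a, ha, h⟩ := A.exists_min_image (ht ω w) hA
  exact ⟨a, mem_mins.2 ⟨ha, h⟩⟩

lemma mh_eq {A : Finset (Fin n → ℤ)} {ω : (Fin n → ℤ) → ℝ} {w : Fin n → ℝ} {a : Fin n → ℤ}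
    (ha : a ∈ mins A ω w) : mh A ω w = ht ω w a := by
  rw [mem_mins] at ha
  refine le_antisymm (mh_le ha.1) (le_csInf ⟨_, a, ha.1, rfl⟩ ?_)
  rintro _ ⟨b, hb, rfl⟩
  exact ha.2 b hb

lemma continuous_mh {A : Finset (Fin n → ℤ)} (hA : A.Nonempty) (ω : (Fin n → ℤ) → ℝ) :
    Continuous (mh A ω) := by
  have : mh A ω = fun w => A.inf' hA (fun a => ht ω w a) := by
    ext w
    rw [mh, Finset.inf'_eq_csInf_image]
  rw [this]
  refine Continuous.finset_inf'_apply hA fun a _ => ?_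
  unfold ht
  fun_prop

/-- the cell -/
def cell (M : Fin n → Finset (Fin n → ℤ)) (S : Finset (Fin n)) : Set (Fin n → ℝ) :=
  ∑ i ∈ S, convexHull ℝ (emb '' (M i : Set (Fin n → ℤ)))

lemma cell_convex (M : Fin n → Finset (Fin n → ℤ)) (S : Finset (Fin n)) : Convex ℝ (cell M S) :=
  convex_sum _ fun _ _ => convex_convexHull _ _

lemma cell_compact (M : Fin n → Finset (Fin n → ℤ)) (S : Finset (Fin n)) :
    IsCompact (cell M S) := by
  classical
  unfold cell
  induction S using Finset.induction_on with
  | empty => simp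
  | insert i S hi ih =>
    rw [Finset.sum_insert hi]
    exact (((M i).finite_toSet.image _).isCompact_convexHull (𝕜 := ℝ)).add ih

lemma mem_cell {M : Fin n → Finset (Fin n → ℤ)} {S : Finset (Fin n)} {p : Fin n → ℝ} :
    p ∈ cell M S ↔ ∃ q : Fin n → Fin n → ℝ,
      (∀ i ∈ S, q i ∈ convexHull ℝ (emb '' (M i : Set (Fin n → ℤ)))) ∧ ∑ i ∈ S, q i = p := by
  rw [cell, Set.mem_finsetSum]
  constructor
  · rintro ⟨g, hg, rfl⟩
    exact ⟨g, fun i hi => hg hi, rfl⟩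
  · rintro ⟨g, hg, rfl⟩
    exact ⟨g, fun {i} hi => hg i hi, rfl⟩

/-- a linear inequality on the generators extends to the hull -/
lemma hull_le {M : Finset (Fin n → ℤ)} {d : Fin n → ℝ} {c : ℝ}
    (h : ∀ a ∈ M, c ≤ emb a ⬝ᵥ d) {q : Fin n → ℝ}
    (hq : q ∈ convexHull ℝ (emb '' (M : Set (Fin n → ℤ)))) : c ≤ q ⬝ᵥ d := by
  have hc : Convex ℝ {q : Fin n → ℝ | c ≤ q ⬝ᵥ d} := by
    refine convex_halfSpace_ge (f := fun q : Fin n → ℝ => q ⬝ᵥ d) ⟨?_, ?_⟩ c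
    · intro x y; exact add_dotProduct x y d
    · intro r x; exact smul_dotProduct r x d
  refine convexHull_min ?_ hc hq
  rintro _ ⟨a, ha, rfl⟩
  exact h a ha

lemma ht_eq (ω : (Fin n → ℤ) → ℝ) (w : Fin n → ℝ) (a : Fin n → ℤ) :
    ht ω w a = ω a + emb a ⬝ᵥ w := rfl

/-- superdifferential inequality -/
lemma superdiff {A : Fin n → Finset (Fin n → ℤ)} {ω : Fin n → (Fin n → ℤ) → ℝ}
    {S : Finset (Fin n)} {w : Fin n → ℝ} {p : Fin n → ℝ}
    (hp : p ∈ cell (fun i => mins (A i) (ω i) w) S) (w' : Fin n → ℝ) :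
    ∑ i ∈ S, mh (A i) (ω i) w' - ∑ i ∈ S, mh (A i) (ω i) w ≤ p ⬝ᵥ (w' - w) := by
  obtain ⟨q, hq, rfl⟩ := mem_cell.1 hp
  rw [← Finset.sum_sub_distrib, sum_dotProduct]
  refine Finset.sum_le_sum fun i hi => hull_le (fun a ha => ?_) (hq i hi)
  rw [mh_eq ha]
  have := mh_le (ω := ω i) (w := w') (mem_mins.1 ha).1
  rw [ht_eq] at *
  rw [dotProduct_sub]
  linarith

/-- covering -/
lemma exists_cell {A : Fin n → Finset (Fin n → ℤ)} (hA : ∀ i, (A i).Nonempty)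
    (ω : Fin n → (Fin n → ℤ) → ℝ) {S : Finset (Fin n)} {p : Fin n → ℝ}
    (hp : p ∈ interior (cell A S)) : ∃ w, p ∈ cell (fun i => mins (A i) (ω i) w) S := by
  classical
  let ψ : (Fin n → ℝ) → ℝ := fun w => p ⬝ᵥ w - ∑ i ∈ S, mh (A i) (ω i) w
  have hψc : Continuous ψ := by
    refine Continuous.sub ?_ ?_
    · exact Continuous.dotProduct continuous_const continuous_id
    · exact continuous_finsetSum _ fun i _ => continuous_mh (hA i) (ω i)
  obtain ⟨ε, hε, hball⟩ := Metric.isOpen_iff.1 isOpen_interior p hp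
  -- upper bound for the sum of minimal heights
  obtain ⟨C, hC⟩ : ∃ C : ℝ, ∀ q ∈ cell A S, ∀ w, ∑ i ∈ S, mh (A i) (ω i) w ≤ C + q ⬝ᵥ w := by
    have : ∀ i, ∃ C : ℝ, ∀ a ∈ A i, ω i a ≤ C := fun i => by
      obtain ⟨C, hC⟩ := ((A i).finite_toSet.image (ω i)).bddAbove
      exact ⟨C, fun a ha => hC ⟨a, ha, rfl⟩⟩
    choose C hC using this
    refine ⟨∑ i ∈ S, C i, fun q hq w => ?_⟩
    obtain ⟨q, hq', rfl⟩ := mem_cell.1 hq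
    rw [sum_dotProduct, ← Finset.sum_add_distrib]
    refine Finset.sum_le_sum fun i hi => ?_
    have : mh (A i) (ω i) w - C i ≤ q i ⬝ᵥ w := by
      refine hull_le (fun a ha => ?_) (hq' i hi)
      have h1 := mh_le (ω := ω i) (w := w) ha
      have h2 := hC i a ha
      rw [ht_eq] at h1
      linarith
    linarith
  have hco : ∀ w, ε / 2 * ‖w‖ - C ≤ ψ w := by
    intro w
    let s : Fin n → ℝ := fun j => ε / 2 * SignType.sign (w j)
    have hs : p - s ∈ cell A S := by
      refine interior_subset (hball ?_)
      rw [Metric.mem_ball, dist_eq_norm]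
      refine lt_of_le_of_lt ((pi_norm_le_iff_of_nonneg (by positivity : (0:ℝ) ≤ ε / 2)).2 ?_)
        (half_lt_self hε)
      intro j
      have : |((SignType.sign (w j) : SignType) : ℝ)| ≤ 1 := by
        rcases lt_trichotomy (w j) 0 with h | h | h <;> simp [h]
      simp only [s, sub_sub_cancel_left, norm_neg, Real.norm_eq_abs, Pi.sub_apply]
      rw [abs_mul, abs_of_pos (half_pos hε)]
      nlinarith
    have h1 := hC _ hs w
    rw [sub_dotProduct] at h1
    have h2 : ε / 2 * ‖w‖ ≤ s ⬝ᵥ w := by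
      have : s ⬝ᵥ w = ε / 2 * ∑ j, |w j| := by
        simp only [dotProduct, s, Finset.mul_sum]
        refine Finset.sum_congr rfl fun j _ => ?_
        rw [mul_assoc, sign_mul_self]
      rw [this]
      refine mul_le_mul_of_nonneg_left ?_ (by positivity)
      refine (pi_norm_le_iff_of_nonneg (Finset.sum_nonneg fun _ _ => abs_nonneg _)).2 fun j => ?_
      exact Finset.single_le_sum (f := fun j => |w j|) (fun _ _ => abs_nonneg _)
        (Finset.mem_univ j)
    simp only [ψ]
    linarith
  have hlim : Filter.Tendsto ψ (Filter.cocompact _) Filter.atTop := by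
    refine Filter.tendsto_atTop_mono hco ?_
    refine Filter.tendsto_atTop_add_const_right _ _ ?_
    exact (tendsto_norm_cocompact_atTop).const_mul_atTop (half_pos hε)
  obtain ⟨w, hw⟩ := hψc.exists_forall_le hlim
  refine ⟨w, ?_⟩
  by_contra hnot
  obtain ⟨g, u, hg1, hg2⟩ := geometric_hahn_banach_point_closed (cell_convex _ S)
    (cell_compact (fun i => mins (A i) (ω i) w) S).isClosed hnot
  -- direction
  let d : Fin n → ℝ := fun j => g (Pi.single j 1)
  have hgd : ∀ q : Fin n → ℝ, g q = q ⬝ᵥ d := by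
    intro q
    conv_lhs => rw [pi_eq_sum_univ' q]
    simp [dotProduct, d, map_sum]
  -- small step keeps the minimizers
  have hstep : ∀ i, ∃ δ > (0:ℝ), ∀ e : ℝ, 0 < e → e < δ →
      mins (A i) (ω i) (w + e • d) ⊆ mins (A i) (ω i) w := by
    intro i
    obtain ⟨a0, ha0⟩ := mins_nonempty (hA i) (ω i) w
    have hev : ∀ b ∈ A i, ∀ᶠ e in nhdsWithin (0:ℝ) (Set.Ioi 0),
        b ∉ mins (A i) (ω i) w → ht (ω i) (w + e • d) a0 < ht (ω i) (w + e • d) b := by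
      intro b hb
      by_cases hbm : b ∈ mins (A i) (ω i) w
      · exact Filter.Eventually.of_forall fun e h => absurd hbm h
      have hlt : ht (ω i) w a0 < ht (ω i) w b := by
        by_contra hcon
        exact hbm (mem_mins.2 ⟨hb, fun c hc => (not_lt.1 hcon).trans ((mem_mins.1 ha0).2 c hc)⟩)
      have hc : ∀ a, Filter.Tendsto (fun e : ℝ => ht (ω i) (w + e • d) a)
          (nhdsWithin 0 (Set.Ioi 0)) (nhds (ht (ω i) w a)) := by
        intro a
        have : Continuous (fun e : ℝ => ht (ω i) (w + e • d) a) := by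
          unfold ht; fun_prop
        have h := this.tendsto 0
        simp only [zero_smul, add_zero] at h
        exact h.mono_left nhdsWithin_le_nhds
      filter_upwards [(hc a0).eventually_lt (hc b) hlt] with e he _ using he
    have := (Filter.eventually_all_finset (A i)).2 hev
    rw [eventually_nhdsWithin_iff, Metric.eventually_nhds_iff] at this
    obtain ⟨δ, hδ, h⟩ := this
    refine ⟨δ, hδ, fun e he0 he b hb => ?_⟩
    rw [mem_mins] at hb
    by_contra hbm
    have := h (by simpa [abs_of_pos he0] using he) he0 b hb.1 hbm
    exact absurd (hb.2 a0 (mem_mins.1 ha0).1) (not_le.2 this)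
  choose δ hδ hstep using hstep
  obtain ⟨e, he0, he⟩ : ∃ e > 0, ∀ i, e < δ i := by
    have : ∀ᶠ e in nhdsWithin (0:ℝ) (Set.Ioi 0), ∀ i, e < δ i := by
      rw [Filter.eventually_all]
      exact fun i => (Filter.Eventually.filter_mono nhdsWithin_le_nhds (eventually_lt_nhds (hδ i)))
    obtain ⟨e, he, h⟩ := (this.and self_mem_nhdsWithin).exists
    exact ⟨e, h, he⟩
  -- pick minimizers at the new point
  choose b hb using fun i => mins_nonempty (hA i) (ω i) (w + e • d)
  have hbw : ∀ i, b i ∈ mins (A i) (ω i) w := fun i => hstep i e he0 (he i) (hb i)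
  have hmem : (∑ i ∈ S, emb (b i)) ∈ cell (fun i => mins (A i) (ω i) w) S :=
    mem_cell.2 ⟨fun i => emb (b i), fun i _ => subset_convexHull _ _ ⟨b i, hbw i, rfl⟩, rfl⟩
  have h1 := hg2 _ hmem
  have h2 := hw (w + e • d)
  have h3 : ∑ i ∈ S, mh (A i) (ω i) (w + e • d)
      = ∑ i ∈ S, mh (A i) (ω i) w + e * ((∑ i ∈ S, emb (b i)) ⬝ᵥ d) := by
    rw [sum_dotProduct, Finset.mul_sum, ← Finset.sum_add_distrib]
    refine Finset.sum_congr rfl fun i _ => ?_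
    rw [mh_eq (hb i), mh_eq (hbw i), ht_eq, ht_eq, dotProduct_add, dotProduct_smul, smul_eq_mul]
    ring
  simp only [ψ, h3, dotProduct_add, dotProduct_smul, smul_eq_mul] at h2
  rw [hgd] at hg1 h1
  have h4 : e * (p ⬝ᵥ d) < e * ((∑ i ∈ S, emb (b i)) ⬝ᵥ d) :=
    mul_lt_mul_of_pos_left (hg1.trans h1) he0
  linarith

end BKK

namespace BKK
variable {n : ℕ}

/-- finitely many directions represent all tuples of minimizers -/
lemma exists_reps (A : Fin n → Finset (Fin n → ℤ)) (ω : Fin n → (Fin n → ℤ) → ℝ) :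
    ∃ W : Finset (Fin n → ℝ), ∀ w, ∃ w' ∈ W, ∀ i, mins (A i) (ω i) w' = mins (A i) (ω i) w := by
  classical
  let F : (Fin n → ℝ) → (Fin n → Finset (Fin n → ℤ)) := fun w i => mins (A i) (ω i) w
  have hfin : (Set.range F).Finite := by
    refine (Set.Finite.pi' (fun i => (A i).powerset.finite_toSet)).subset ?_
    rintro _ ⟨w, rfl⟩ i
    simp only [Finset.mem_coe, Finset.mem_powerset, F]
    exact fun a ha => (mem_mins.1 ha).1
  obtain ⟨W, -, h1⟩ := Set.exists_subset_bijOn Set.univ F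
  rw [Set.image_univ] at h1
  have hWf : W.Finite := Set.Finite.of_finite_image (by rw [h1.image_eq]; exact hfin) h1.injOn
  refine ⟨hWf.toFinset, fun w => ?_⟩
  obtain ⟨w', hw', h⟩ : F w ∈ F '' W := by rw [h1.image_eq]; exact ⟨w, rfl⟩
  exact ⟨w', by simpa using hw', fun i => congrFun h i⟩

lemma volume_translate (p0 : Fin n → ℝ) (s : Set (Fin n → ℝ)) :
    volume ((fun p => p0 + p) '' s) = volume s := by
  rw [Set.image_add_left, measure_preimage_add]

lemma cell_subset {A B : Fin n → Finset (Fin n → ℤ)} (h : ∀ i, A i ⊆ B i) (S : Finset (Fin n)) :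
    cell A S ⊆ cell B S := by
  intro p hp
  obtain ⟨q, hq, rfl⟩ := mem_cell.1 hp
  exact mem_cell.2 ⟨q, fun i hi => convexHull_mono
    (Set.image_mono (Finset.coe_subset.2 (h i))) (hq i hi), rfl⟩

lemma aedisjoint_cell {A : Fin n → Finset (Fin n → ℤ)} {ω : Fin n → (Fin n → ℤ) → ℝ}
    (S : Finset (Fin n)) {w w' : Fin n → ℝ} (hne : w ≠ w') :
    AEDisjoint volume (cell (fun i => mins (A i) (ω i) w) S)
      (cell (fun i => mins (A i) (ω i) w') S) := by
  classical
  let g : (Fin n → ℝ) →ₗ[ℝ] ℝ :=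
    { toFun := fun p => p ⬝ᵥ (w' - w)
      map_add' := fun x y => add_dotProduct x y _
      map_smul' := fun r x => smul_dotProduct r x _ }
  set c : ℝ := ∑ i ∈ S, mh (A i) (ω i) w' - ∑ i ∈ S, mh (A i) (ω i) w with hc
  have hsub : cell (fun i => mins (A i) (ω i) w) S ∩ cell (fun i => mins (A i) (ω i) w') S
      ⊆ {p | g p = c} := by
    rintro p ⟨h1, h2⟩
    have e1 := superdiff h1 w'
    have e2 := superdiff h2 w
    have e3 : p ⬝ᵥ (w - w') = - (p ⬝ᵥ (w' - w)) := by
      rw [← dotProduct_neg, neg_sub]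
    simp only [Set.mem_ofPred_eq, g, LinearMap.coe_mk, AddHom.coe_mk]
    linarith
  refine measure_mono_null hsub ?_
  by_cases hemp : {p | g p = c} = ∅
  · simp [hemp]
  obtain ⟨p0, hp0⟩ := Set.nonempty_iff_ne_empty.2 hemp
  have : {p | g p = c} = (fun p => p0 + p) '' (LinearMap.ker g : Set (Fin n → ℝ)) := by
    ext p
    simp only [Set.mem_ofPred_eq, Set.mem_image, SetLike.mem_coe, LinearMap.mem_ker]
    constructor
    · intro h
      exact ⟨p - p0, by rw [map_sub, h, hp0, sub_self], by abel⟩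
    · rintro ⟨q, hq, rfl⟩
      rw [map_add, hq, hp0, add_zero]
  rw [this, volume_translate]
  refine Measure.addHaar_submodule _ _ ?_
  intro htop
  have : g (w' - w) = 0 := LinearMap.mem_ker.1 (htop ▸ Submodule.mem_top)
  simp only [g, LinearMap.coe_mk, AddHom.coe_mk, dotProduct_self_eq_zero] at this
  exact hne (sub_eq_zero.1 this).symm

lemma volume_cell_eq {A : Fin n → Finset (Fin n → ℤ)} (hA : ∀ i, (A i).Nonempty)
    (ω : Fin n → (Fin n → ℤ) → ℝ) (W : Finset (Fin n → ℝ))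
    (hW : ∀ w, ∃ w' ∈ W, ∀ i, mins (A i) (ω i) w' = mins (A i) (ω i) w) (S : Finset (Fin n)) :
    (volume (cell A S)).toReal
      = ∑ w ∈ W, (volume (cell (fun i => mins (A i) (ω i) w) S)).toReal := by
  have h1 : volume (cell A S) = volume (⋃ w ∈ W, cell (fun i => mins (A i) (ω i) w) S) := by
    apply le_antisymm
    · have : volume (cell A S) ≤ volume (interior (cell A S)) := by
        have hf := (cell_convex A S).addHaar_frontier volume
        calc volume (cell A S) ≤ volume (interior (cell A S) ∪ frontier (cell A S)) := by
              refine measure_mono fun p hp => ?_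
              rw [← closure_eq_interior_union_frontier]
              exact subset_closure hp
          _ ≤ volume (interior (cell A S)) + volume (frontier (cell A S)) := measure_union_le _ _
          _ = _ := by rw [hf, add_zero]
      refine this.trans (measure_mono fun p hp => ?_)
      obtain ⟨w, hw⟩ := exists_cell hA ω hp
      obtain ⟨w', hw', h⟩ := hW w
      refine Set.mem_iUnion₂.2 ⟨w', hw', ?_⟩
      rwa [funext h]
    · refine measure_mono (Set.iUnion₂_subset fun w _ => cell_subset (fun i a ha => ?_) S)
      exact (mem_mins.1 ha).1
  rw [h1, measure_biUnion_finset₀, ENNReal.toReal_sum]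
  · exact fun w _ => (cell_compact _ S).measure_lt_top.ne
  · intro w _ w' _ hne
    exact aedisjoint_cell S hne
  · exact fun w _ => (cell_compact _ S).measurableSet.nullMeasurableSet

/-- the alternating sum -/
noncomputable def mv (M : Fin n → Finset (Fin n → ℤ)) : ℝ :=
  ∑ S : Finset (Fin n), (-1 : ℝ) ^ (n - S.card) * (volume (cell M S)).toReal

lemma mv_eq_zero {M : Fin n → Finset (Fin n → ℤ)} {i : Fin n} {a : Fin n → ℤ} (h : M i = {a}) :
    mv M = 0 := by
  classical
  have hv : ∀ S : Finset (Fin n), i ∉ S → volume (cell M (insert i S)) = volume (cell M S) := by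
    intro S hS
    rw [cell, Finset.sum_insert hS, h]
    simp only [Finset.coe_singleton, Set.image_singleton, convexHull_singleton]
    rw [Set.singleton_add, volume_translate]
    rfl
  unfold mv
  refine Finset.sum_involution (fun S _ => if i ∈ S then S.erase i else insert i S) ?_ ?_ ?_ ?_
  · intro S _
    have key : ∀ S : Finset (Fin n), i ∉ S →
        (-1 : ℝ) ^ (n - S.card) * (volume (cell M S)).toReal +
        (-1 : ℝ) ^ (n - (insert i S).card) * (volume (cell M (insert i S))).toReal = 0 := by
      intro S hS
      rw [hv S hS, Finset.card_insert_of_notMem hS]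
      have hlt : S.card < n := by
        have := Finset.card_lt_univ_of_notMem hS
        simpa using this
      obtain ⟨k, hk⟩ : ∃ k, n - S.card = k + 1 := ⟨n - S.card - 1, by omega⟩
      rw [hk, show n - (S.card + 1) = k by omega, pow_succ]
      ring
    by_cases hi : i ∈ S
    · simp only [hi, if_true]
      have := key (S.erase i) (Finset.notMem_erase i S)
      rw [Finset.insert_erase hi] at this
      rw [add_comm]; exact this
    · simp only [hi, if_false]
      exact key S hi
  · intro S _ _
    by_cases hi : i ∈ S
    · simp only [hi, if_true]
      intro h; exact Finset.notMem_erase i S (by rw [h]; exact hi)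
    · simp only [hi, if_false]
      intro h; exact hi (by rw [← h]; exact Finset.mem_insert_self i S)
  · intro S _; exact Finset.mem_univ _
  · intro S _
    by_cases hi : i ∈ S
    · simp [hi, Finset.insert_erase hi]
    · simp [hi, Finset.erase_insert hi]

lemma mv_pairs {M : Fin n → Finset (Fin n → ℤ)} {a b : Fin n → Fin n → ℤ}
    (h : ∀ i, M i = {a i, b i}) :
    mv M = |((Matrix.of fun i j => a i j - b i j : Matrix (Fin n) (Fin n) ℤ).det : ℝ)| := by
  classical
  have hvol : ∀ S : Finset (Fin n), volume (cell M S) =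
      ENNReal.ofReal |(Matrix.of fun i j => if i ∈ S then ((a i j : ℝ) - b i j) else 0 :
        Matrix (Fin n) (Fin n) ℝ).det| := by
    intro S
    let v : Fin n → Fin n → ℝ := fun i => if i ∈ S then emb (a i) - emb (b i) else 0
    have hpar : volume (parallelepiped v) = ENNReal.ofReal |(Matrix.of v).det| := by
      have := Measure.addHaar_parallelepiped (Pi.basisFun ℝ (Fin n)) v
      rw [Module.Basis.addHaar_def, Module.Basis.parallelepiped_basisFun,
        addHaarMeasure_eq_volume_pi] at this
      rw [this, Pi.basisFun_det]
      rfl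
    have hcell : cell M S = {∑ i ∈ S, emb (b i)} + parallelepiped v := by
      rw [parallelepiped_eq_sum_segment, cell]
      have h1 : ∑ i, segment ℝ 0 (v i) = ∑ i ∈ S, segment ℝ 0 (emb (a i) - emb (b i)) := by
        rw [← Finset.sum_subset (Finset.subset_univ S)]
        · exact Finset.sum_congr rfl fun i hi => by simp [v, hi]
        · intro i _ hi
          simp [v, hi]; rfl
      have h2 : ({∑ i ∈ S, emb (b i)} : Set (Fin n → ℝ)) = ∑ i ∈ S, {emb (b i)} := by
        exact map_sum (Set.singletonAddMonoidHom (α := Fin n → ℝ)) _ S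
      rw [h1, h2, ← Finset.sum_add_distrib]
      refine Finset.sum_congr rfl fun i _ => ?_
      rw [h i, Finset.coe_insert, Finset.coe_singleton, Set.image_pair, convexHull_pair,
        Set.singleton_add, segment_symm]
      have := segment_translate_image ℝ (emb (b i)) 0 (emb (a i) - emb (b i))
      rw [this]
      simp
    rw [hcell, Set.singleton_add, volume_translate, hpar]
    congr 3
    ext i j
    by_cases hi : i ∈ S <;> simp [v, hi, emb]
  unfold mv
  rw [Finset.sum_eq_single Finset.univ]
  · rw [hvol]
    simp only [Finset.mem_univ, if_true, Finset.card_univ, Fintype.card_fin, Nat.sub_self, pow_zero,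
      one_mul]
    rw [ENNReal.toReal_ofReal (abs_nonneg _)]
    congr 1
    have hd := RingHom.map_det (Int.castRingHom ℝ)
      (Matrix.of fun i j => a i j - b i j : Matrix (Fin n) (Fin n) ℤ)
    rw [eq_intCast] at hd
    rw [hd]
    congr 1
    ext i j
    simp
  · intro S _ hS
    obtain ⟨i, hi⟩ : ∃ i, i ∉ S := by
      by_contra hcon
      push Not at hcon
      exact hS (Finset.eq_univ_iff_forall.2 hcon)
    rw [hvol, Matrix.det_eq_zero_of_row_eq_zero i (by simp [hi])]
    simp
  · intro h; exact absurd (Finset.mem_univ _) h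

lemma mv_sum {A : Fin n → Finset (Fin n → ℤ)} (hA : ∀ i, (A i).Nonempty)
    (ω : Fin n → (Fin n → ℤ) → ℝ) (W : Finset (Fin n → ℝ))
    (hW : ∀ w, ∃ w' ∈ W, ∀ i, mins (A i) (ω i) w' = mins (A i) (ω i) w) :
    mv A = ∑ w ∈ W, mv (fun i => mins (A i) (ω i) w) := by
  unfold mv
  rw [Finset.sum_comm]
  refine Finset.sum_congr rfl fun S _ => ?_
  rw [volume_cell_eq hA ω W hW S, Finset.mul_sum]

end BKK

namespace BKK
variable {n : ℕ}

/-- difference matrix -/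
def dm (a b : Fin n → Fin n → ℤ) : Matrix (Fin n) (Fin n) ℤ := Matrix.of fun i j => a i j - b i j

/-- genericity of the heights -/
def Gen (ω : Fin n → (Fin n → ℤ) → ℝ) : Prop :=
  LinearIndependent ℤ (fun p : Fin n × (Fin n → ℤ) => ω p.1 p.2)

lemma exists_gen (n : ℕ) : ∃ ω : Fin n → (Fin n → ℤ) → ℝ, Gen ω := by
  let B := Module.Basis.ofVectorSpace ℚ ℝ
  have hinf : Infinite (Module.Basis.ofVectorSpaceIndex ℚ ℝ) := by
    by_contra h
    rw [not_infinite_iff_finite] at h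
    have := B.mk_eq_rank''
    rw [Real.rank_rat_real] at this
    have h2 := Cardinal.lt_aleph0_of_finite (Module.Basis.ofVectorSpaceIndex ℚ ℝ)
    rw [this] at h2
    exact absurd h2 (not_lt.2 Cardinal.aleph0_le_continuum)
  obtain ⟨e, he⟩ := Countable.exists_injective_nat (Fin n × (Fin n → ℤ))
  let e' := Infinite.natEmbedding (Module.Basis.ofVectorSpaceIndex ℚ ℝ)
  refine ⟨fun i a => B (e' (e (i, a))), ?_⟩
  have h := B.linearIndependent.comp (fun p => e' (e p)) (e'.injective.comp he)
  exact h.restrict_scalars (R := ℤ) (by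
    intro x y hxy
    simpa using hxy)

variable {Γ : Type*} [AddCommGroup Γ]

/-- abstract height -/
def gh (ω : Fin n → (Fin n → ℤ) → ℝ) (T : ℝ →+ Γ) (g : Fin n → Γ) (p : Fin n × (Fin n → ℤ)) : Γ :=
  T (ω p.1 p.2) + ∑ j, p.2 j • g j

lemma core {ω : Fin n → (Fin n → ℤ) → ℝ} (hω : Gen ω) {T : ℝ →+ Γ}
    (hT : Function.Injective T) (g : Fin n → Γ) (c : (Fin n × (Fin n → ℤ)) →₀ ℤ)
    (h1 : Finsupp.linearCombination ℤ (gh ω T g) c = 0)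
    (h2 : Finsupp.linearCombination ℤ (fun p : Fin n × (Fin n → ℤ) => p.2) c = 0) : c = 0 := by
  have key : ∀ c : (Fin n × (Fin n → ℤ)) →₀ ℤ, Finsupp.linearCombination ℤ (gh ω T g) c
      = T (Finsupp.linearCombination ℤ (fun p : Fin n × (Fin n → ℤ) => ω p.1 p.2) c)
        + ∑ j, (Finsupp.linearCombination ℤ (fun p : Fin n × (Fin n → ℤ) => p.2) c) j • g j := by
    intro c
    induction c using Finsupp.induction_linear with
    | zero => simp
    | add x y hx hy =>
      simp only [map_add, hx, hy, Pi.add_apply, add_smul, Finset.sum_add_distrib]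
      abel
    | single p r =>
      simp only [Finsupp.linearCombination_single, gh, smul_add, map_zsmul, Pi.smul_apply,
        Finset.smul_sum, smul_assoc]
  rw [key, h2] at h1
  simp only [Pi.zero_apply, zero_smul, Finset.sum_const_zero, add_zero] at h1
  exact (linearIndependent_iff.1 hω) c (hT (by rw [h1, map_zero]))

lemma det_ne {ω : Fin n → (Fin n → ℤ) → ℝ} (hω : Gen ω) {T : ℝ →+ Γ}
    (hT : Function.Injective T) (g : Fin n → Γ) {a b : Fin n → Fin n → ℤ} (hab : ∀ i, a i ≠ b i)
    (h : ∀ i, gh ω T g (i, a i) = gh ω T g (i, b i)) : (dm a b).det ≠ 0 := by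
  classical
  intro hdet
  obtain ⟨c, hc, hc2⟩ := Matrix.exists_vecMul_eq_zero_iff.2 hdet
  apply hc
  let C : (Fin n × (Fin n → ℤ)) →₀ ℤ :=
    ∑ i, (c i) • (Finsupp.single (i, a i) 1 - Finsupp.single (i, b i) 1)
  have hC : C = 0 := by
    apply core hω hT g
    · simp [C, h]
    · ext j
      have := congrFun hc2 j
      simpa [C, Matrix.vecMul, dotProduct, dm] using this
  ext i
  have := DFunLike.congr_fun hC (i, a i)
  simp only [C, Finsupp.coe_finset_sum, Finset.sum_apply, Finsupp.coe_smul, Pi.smul_apply,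
    Finsupp.coe_sub, Pi.sub_apply, Finsupp.single_apply, Prod.mk.injEq, Finsupp.coe_zero,
    Pi.zero_apply] at this
  rw [Finset.sum_eq_single i] at this
  · simpa [(hab i).symm] using this
  · intro k _ hk
    simp [hk]
  · simp

lemma third {ω : Fin n → (Fin n → ℤ) → ℝ} (hω : Gen ω) {T : ℝ →+ Γ}
    (hT : Function.Injective T) (g : Fin n → Γ) {a b : Fin n → Fin n → ℤ} (hab : ∀ i, a i ≠ b i)
    (h : ∀ i, gh ω T g (i, a i) = gh ω T g (i, b i)) (i : Fin n) (a' : Fin n → ℤ)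
    (h' : gh ω T g (i, a') = gh ω T g (i, b i)) : a' = a i ∨ a' = b i := by
  classical
  by_contra! hcon
  have hD := det_ne hω hT g hab h
  let c := Matrix.vecMul (a' - b i) (dm a b).adjugate
  have hc : Matrix.vecMul c (dm a b) = (dm a b).det • (a' - b i) := by
    rw [Matrix.vecMul_vecMul, Matrix.adjugate_mul, Matrix.vecMul_smul, Matrix.vecMul_one]
  let C : (Fin n × (Fin n → ℤ)) →₀ ℤ :=
    (dm a b).det • (Finsupp.single (i, a') 1 - Finsupp.single (i, b i) 1) -
    ∑ i, (c i) • (Finsupp.single (i, a i) 1 - Finsupp.single (i, b i) 1)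
  have hC : C = 0 := by
    apply core hω hT g
    · simp [C, h, h']
    · ext j
      have := congrFun hc j
      simp only [Matrix.vecMul, dotProduct, Pi.smul_apply, Pi.sub_apply, smul_eq_mul] at this
      simp only [C, map_sub, map_smul, map_sum, Finsupp.linearCombination_single, one_smul,
        Pi.sub_apply, Pi.smul_apply, Finset.sum_apply, smul_eq_mul, Pi.zero_apply, ← this]
      simp [dm]
  apply hD
  have := DFunLike.congr_fun hC (i, a')
  simp only [C, Finsupp.coe_finset_sum, Finset.sum_apply, Finsupp.coe_smul, Pi.smul_apply,
    Finsupp.coe_sub, Pi.sub_apply, Finsupp.single_apply, Prod.mk.injEq, Finsupp.coe_zero,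
    Pi.zero_apply] at this
  rw [Finset.sum_eq_zero] at this
  · simpa [hcon.2.symm] using this
  · intro k _
    by_cases hk : k = i
    · subst hk
      simp [hcon.1.symm, hcon.2.symm]
    · simp [hk]

lemma cramer [IsAddTorsionFree Γ] {M : Matrix (Fin n) (Fin n) ℤ} (hM : M.det ≠ 0) {g : Fin n → Γ}
    (h : ∀ i, ∑ j, M i j • g j = 0) : g = 0 := by
  ext k
  have : M.det • g k = 0 := by
    calc M.det • g k = ∑ j, ((M.adjugate * M) k j) • g j := by
          rw [Matrix.adjugate_mul, Finset.sum_eq_single k]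
          · simp
          · intro j _ hj; simp [Matrix.one_apply_ne hj.symm]
          · simp
      _ = ∑ i, M.adjugate k i • ∑ j, M i j • g j := by
          simp only [Matrix.mul_apply, Finset.sum_smul, Finset.smul_sum, mul_smul]
          rw [Finset.sum_comm]
      _ = 0 := by simp [h]
  exact (smul_eq_zero_iff_right hM).1 this

lemma exists_real [IsAddTorsionFree Γ] {ω : Fin n → (Fin n → ℤ) → ℝ} (hω : Gen ω) {T : ℝ →+ Γ}
    (hT : Function.Injective T) (g : Fin n → Γ) {a b : Fin n → Fin n → ℤ} (hab : ∀ i, a i ≠ b i)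
    (h : ∀ i, gh ω T g (i, a i) = gh ω T g (i, b i)) : ∃ w : Fin n → ℝ, ∀ j, g j = T (w j) := by
  have hD := det_ne hω hT g hab h
  let M : Matrix (Fin n) (Fin n) ℝ := (dm a b).map (Int.cast)
  have hM : IsUnit M.det := by
    have hd := RingHom.map_det (Int.castRingHom ℝ) (dm a b)
    have : M.det = ((dm a b).det : ℝ) := by
      rw [eq_intCast] at hd
      rw [hd]; rfl
    rw [this, isUnit_iff_ne_zero]
    exact_mod_cast hD
  let r : Fin n → ℝ := fun i => ω i (b i) - ω i (a i)
  let w := M⁻¹.mulVec r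
  have hw : M.mulVec w = r := by
    rw [Matrix.mulVec_mulVec, Matrix.mul_nonsing_inv _ hM, Matrix.one_mulVec]
  refine ⟨w, fun j => ?_⟩
  have : (fun j => g j - T (w j)) = 0 := by
    apply cramer hD
    intro i
    have h1 := h i
    have h2 : T (∑ j, (dm a b) i j • w j) = T (r i) := by
      congr 1
      rw [← hw]
      simp [Matrix.mulVec, dotProduct, M]
    simp only [map_sum, map_zsmul, r, map_sub] at h2
    simp only [smul_sub, Finset.sum_sub_distrib, h2]
    simp only [gh] at h1
    have h3 : ∑ j, dm a b i j • g j = ∑ j, a i j • g j - ∑ j, b i j • g j := by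
      simp [dm, sub_smul]
    rw [h3, sub_eq_zero, sub_eq_sub_iff_add_eq_add, add_comm _ (T _), h1, add_comm]
  exact sub_eq_zero.1 (congrFun this j)

lemma gh_real (ω : Fin n → (Fin n → ℤ) → ℝ) (w : Fin n → ℝ) (i : Fin n) (a : Fin n → ℤ) :
    gh ω (AddMonoidHom.id ℝ) w (i, a) = ht (ω i) w a := by
  simp [gh, ht]

lemma ht_eq_of_mins {A : Finset (Fin n → ℤ)} {ω : (Fin n → ℤ) → ℝ} {w : Fin n → ℝ}
    {a b : Fin n → ℤ} (ha : a ∈ mins A ω w) (hb : b ∈ mins A ω w) : ht ω w a = ht ω w b := by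
  rw [← mh_eq ha, ← mh_eq hb]

lemma pairs_of {A : Fin n → Finset (Fin n → ℤ)} {ω : Fin n → (Fin n → ℤ) → ℝ} (hω : Gen ω)
    {w : Fin n → ℝ} {a b : Fin n → Fin n → ℤ} (hab : ∀ i, a i ≠ b i)
    (ha : ∀ i, a i ∈ mins (A i) (ω i) w) (hb : ∀ i, b i ∈ mins (A i) (ω i) w) :
    (dm a b).det ≠ 0 ∧ ∀ i, mins (A i) (ω i) w = {a i, b i} := by
  have h : ∀ i, gh ω (AddMonoidHom.id ℝ) w (i, a i) = gh ω (AddMonoidHom.id ℝ) w (i, b i) := by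
    intro i
    rw [gh_real, gh_real]
    exact ht_eq_of_mins (ha i) (hb i)
  refine ⟨det_ne hω (fun x y h => h) w hab h, fun i => ?_⟩
  ext c
  simp only [Finset.mem_insert, Finset.mem_singleton]
  constructor
  · intro hc
    refine third hω (T := AddMonoidHom.id ℝ) (fun x y h => h) w hab h i c ?_
    rw [gh_real, gh_real]
    exact ht_eq_of_mins hc (hb i)
  · rintro (rfl | rfl)
    · exact ha i
    · exact hb i

lemma w_unique {A : Fin n → Finset (Fin n → ℤ)} {ω : Fin n → (Fin n → ℤ) → ℝ} (hω : Gen ω)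
    {w w' : Fin n → ℝ} {a b : Fin n → Fin n → ℤ} (hab : ∀ i, a i ≠ b i)
    (ha : ∀ i, a i ∈ mins (A i) (ω i) w) (hb : ∀ i, b i ∈ mins (A i) (ω i) w)
    (ha' : ∀ i, a i ∈ mins (A i) (ω i) w') (hb' : ∀ i, b i ∈ mins (A i) (ω i) w') : w = w' := by
  have hD := (pairs_of hω hab ha hb).1
  have : w - w' = 0 := by
    apply cramer hD
    intro i
    have h1 := ht_eq_of_mins (ha i) (hb i)
    have h2 := ht_eq_of_mins (ha' i) (hb' i)
    simp only [ht] at h1 h2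
    simp only [dm, Matrix.of_apply, Pi.sub_apply, zsmul_eq_mul, Int.cast_sub, sub_mul, mul_sub,
      Finset.sum_sub_distrib]
    linarith
  exact sub_eq_zero.1 this

end BKK

namespace BKK
variable {n : ℕ}

/-- monomial -/
def mon {G : Type*} [CommGroup G] (y : Fin n → G) (a : Fin n → ℤ) : G := ∏ j, y j ^ a j

lemma mon_add {G : Type*} [CommGroup G] (y : Fin n → G) (a b : Fin n → ℤ) :
    mon y (a + b) = mon y a * mon y b := by
  simp [mon, zpow_add, Finset.prod_mul_distrib]

lemma mon_zero {G : Type*} [CommGroup G] (y : Fin n → G) : mon y 0 = 1 := by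
  simp [mon]

lemma mon_sub {G : Type*} [CommGroup G] (y : Fin n → G) (a b : Fin n → ℤ) :
    mon y (a - b) = mon y a / mon y b := by
  simp [mon, zpow_sub, Finset.prod_mul_distrib, div_eq_mul_inv]

lemma mon_div {G : Type*} [CommGroup G] (y z : Fin n → G) (a : Fin n → ℤ) :
    mon (y / z) a = mon y a / mon z a := by
  simp [mon, div_zpow]

lemma mon_mul {G : Type*} [CommGroup G] (y z : Fin n → G) (a : Fin n → ℤ) :
    mon (y * z) a = mon y a * mon z a := by
  simp [mon, mul_zpow, Finset.prod_mul_distrib]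

lemma mon_map {G H : Type*} [CommGroup G] [CommGroup H] (φ : G →* H) (y : Fin n → G)
    (a : Fin n → ℤ) : mon (fun j => φ (y j)) a = φ (mon y a) := by
  simp [mon]

lemma mon_single {G : Type*} [CommGroup G] (y : Fin n → G) (j : Fin n) :
    mon y (Pi.single j 1) = y j := by
  unfold mon
  rw [Finset.prod_eq_single j]
  · simp
  · intro k _ hk; simp [Pi.single_eq_of_ne hk]
  · simp

/-- the character of a point -/
def chr {G : Type*} [CommGroup G] (y : Fin n → G) : (Fin n → ℤ) →+ Additive G where
  toFun a := Additive.ofMul (mon y a)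
  map_zero' := by rw [mon_zero]; rfl
  map_add' a b := by rw [mon_add]; rfl

lemma count_one {κ : Type*} [Field κ] {M : Matrix (Fin n) (Fin n) ℤ} (hM : M.det ≠ 0) :
    {y : Fin n → κˣ | ∀ i, mon y (M i) = 1}.Finite ∧
    {y : Fin n → κˣ | ∀ i, mon y (M i) = 1}.ncard ≤ M.det.natAbs := by
  classical
  let N : Submodule ℤ (Fin n → ℤ) := Submodule.span ℤ (Set.range M)
  have hli : LinearIndependent ℤ M := Matrix.linearIndependent_rows_of_det_ne_zero hM
  let bN : Module.Basis (Fin n) ℤ N := Module.Basis.span hli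
  have hcard : M.det.natAbs = Nat.card ((Fin n → ℤ) ⧸ N) := by
    rw [← Submodule.natAbs_det_basis_change (Pi.basisFun ℤ (Fin n)) N bN, Pi.basisFun_det]
    congr 2
    ext i j
    exact (congrFun (congrArg Subtype.val (Module.Basis.span_apply hli i)) j).symm
  have hfin : Finite ((Fin n → ℤ) ⧸ N) := by
    apply Nat.finite_of_card_ne_zero
    rw [← hcard]
    simpa using hM
  let Q := Multiplicative ((Fin n → ℤ) ⧸ N)
  have hfQ : Finite Q := hfin
  have := Fintype.ofFinite Q
  have hle : Cardinal.mk (Q →* κ) ≤ Module.finrank κ (Q → κ) :=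
    (linearIndependent_monoidHom Q κ).cardinalMk_le_finrank
  have hfh : Finite (Q →* κ) := Cardinal.lt_aleph0_iff_finite.1 (hle.trans_lt Cardinal.natCast_lt_aleph0)
  have hle2 : Nat.card (Q →* κ) ≤ M.det.natAbs := by
    have h1 := Cardinal.toNat_le_toNat hle (Cardinal.natCast_lt_aleph0)
    rw [Module.finrank_fintype_fun_eq_card, Cardinal.toNat_natCast, ← Nat.card_eq_fintype_card] at h1
    rw [hcard]
    exact h1
  set Y := {y : Fin n → κˣ | ∀ i, mon y (M i) = 1} with hY
  have hker : ∀ y ∈ Y, N.toAddSubgroup ≤ (chr y).ker := by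
    intro y hy
    have : N ≤ AddSubgroup.toIntSubmodule (chr y).ker := by
      rw [Submodule.span_le]
      rintro _ ⟨i, rfl⟩
      exact hy i
    exact this
  let Φ : Y → (Q →* κ) := fun y => (Units.coeHom κ).comp
    (AddMonoidHom.toMultiplicativeLeft (QuotientAddGroup.lift N.toAddSubgroup (chr y.1) (hker y.1 y.2)))
  have hΦ : Function.Injective Φ := by
    intro y z hyz
    ext j
    have := DFunLike.congr_fun hyz (Multiplicative.ofAdd (Submodule.Quotient.mk (Pi.single j 1)))
    change ((mon y.1 (Pi.single j 1) : κˣ) : κ) = (mon z.1 (Pi.single j 1) : κˣ) at this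
    rwa [mon_single, mon_single] at this
  have hYf : Finite Y := Finite.of_injective Φ hΦ
  refine ⟨Set.toFinite _, ?_⟩
  rw [← Nat.card_coe_set_eq]
  exact (Nat.card_le_card_of_injective Φ hΦ).trans hle2

lemma count_mono {κ : Type*} [Field κ] {M : Matrix (Fin n) (Fin n) ℤ} (hM : M.det ≠ 0)
    (e : Fin n → κˣ) :
    {y : Fin n → κˣ | ∀ i, mon y (M i) = e i}.Finite ∧
    {y : Fin n → κˣ | ∀ i, mon y (M i) = e i}.ncard ≤ M.det.natAbs := by
  obtain h | ⟨y0, hy0⟩ := {y : Fin n → κˣ | ∀ i, mon y (M i) = e i}.eq_empty_or_nonempty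
  · rw [h]; simp
  obtain ⟨h1, h2⟩ := count_one (κ := κ) hM
  have hinj : Function.Injective (fun y : Fin n → κˣ => y / y0) := div_left_injective
  have hmaps : ∀ y ∈ {y : Fin n → κˣ | ∀ i, mon y (M i) = e i}, y / y0 ∈
      {y : Fin n → κˣ | ∀ i, mon y (M i) = 1} := by
    intro y hy i
    rw [mon_div, hy i, hy0 i, div_self']
  exact ⟨Set.Finite.of_injOn hmaps hinj.injOn h1,
    (Set.ncard_le_ncard_of_injOn _ hmaps hinj.injOn h1).trans h2⟩

end BKK

namespace BKK
variable {n : ℕ}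

/-- first order expansions `u ≡ 1 + e h` modulo `e 𝔪` -/
def expand {R : Type*} [CommRing R] [IsLocalRing R] (e : R) (he : e ∈ IsLocalRing.maximalIdeal R) :
    Subgroup (Rˣ × Multiplicative R) where
  carrier := {p | ∃ μ ∈ IsLocalRing.maximalIdeal R, (p.1 : R) = 1 + e * (p.2.toAdd + μ)}
  one_mem' := ⟨0, Ideal.zero_mem _, by simp⟩
  mul_mem' := by
    rintro ⟨u, h⟩ ⟨u', h'⟩ ⟨μ, hμ, h1⟩ ⟨μ', hμ', h2⟩
    refine ⟨μ + μ' + e * ((h.toAdd + μ) * (h'.toAdd + μ')),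
      Ideal.add_mem _ (Ideal.add_mem _ hμ hμ') (Ideal.mul_mem_right _ _ he), ?_⟩
    simp only [Prod.mk_mul_mk, Units.val_mul, toAdd_mul] at *
    rw [h1, h2]
    ring
  inv_mem' := by
    rintro ⟨u, h⟩ ⟨μ, hμ, h1⟩
    simp only at h1
    let k : R := -(h.toAdd + μ) * ((u⁻¹ : Rˣ) : R)
    refine ⟨-μ - (h.toAdd + μ) * (e * k), ?_, ?_⟩
    · exact Ideal.sub_mem _ (Ideal.neg_mem_iff _ |>.2 hμ)
        (Ideal.mul_mem_left _ _ (Ideal.mul_mem_right _ _ he))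
    · have hu : (u : R) * ((u⁻¹ : Rˣ) : R) = 1 := by simp
      simp only [Prod.inv_mk, toAdd_inv, k]
      linear_combination (1 - e * (h.toAdd + μ)) * hu + (((u⁻¹ : Rˣ) : R) * (e * (h.toAdd + μ) - 1)) * h1

lemma expand_mon {R : Type*} [CommRing R] [IsLocalRing R] {e : R}
    (he : e ∈ IsLocalRing.maximalIdeal R) {z : Fin n → Rˣ} {η : Fin n → R}
    (h : ∀ j, (z j : R) = 1 + e * η j) (c : Fin n → ℤ) :
    ∃ μ ∈ IsLocalRing.maximalIdeal R, ((mon z c : Rˣ) : R) = 1 + e * (∑ j, (c j : R) * η j + μ) := by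
  have h1 : ∀ j, (z j, Multiplicative.ofAdd (η j)) ∈ expand e he :=
    fun j => ⟨0, Ideal.zero_mem _, by simp [h j]⟩
  have h2 : ∏ j, (z j, Multiplicative.ofAdd (η j)) ^ c j ∈ expand e he :=
    Subgroup.prod_mem _ fun j _ => Subgroup.zpow_mem _ (h1 j) _
  obtain ⟨μ, hμ, h3⟩ := h2
  refine ⟨μ, hμ, ?_⟩
  rw [Prod.fst_prod, Prod.snd_prod] at h3
  simp only [Prod.pow_fst, Prod.pow_snd, toAdd_prod, toAdd_zpow, toAdd_ofAdd, zsmul_eq_mul] at h3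
  exact h3

variable {L : Type*} [Field L] (V : ValuationSubring L)

/-- zeros over the valuation ring -/
def Zr (A : Fin n → Finset (Fin n → ℤ)) (s : Fin n → (Fin n → ℤ) → V) : Set (Fin n → Vˣ) :=
  {y | ∀ i, ∑ c ∈ A i, s i c * ((mon y c : Vˣ) : V) = 0}

/-- shape of the reduced system -/
structure Shape (A : Fin n → Finset (Fin n → ℤ)) (s : Fin n → (Fin n → ℤ) → V)
    (a b : Fin n → Fin n → ℤ) : Prop where
  ha : ∀ i, a i ∈ A i
  hb : ∀ i, b i ∈ A i
  hab : ∀ i, a i ≠ b i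
  sa : ∀ i, s i (a i) = 1
  sb : ∀ i, s i (b i) = 1
  so : ∀ i, ∀ c ∈ A i, c ≠ a i → c ≠ b i → s i c ∈ IsLocalRing.maximalIdeal V

variable {V} {A : Fin n → Finset (Fin n → ℤ)} {s : Fin n → (Fin n → ℤ) → V}
    {a b : Fin n → Fin n → ℤ}

lemma Shape.red (h : Shape V A s a b) (i : Fin n) (F : (Fin n → ℤ) → V) :
    IsLocalRing.residue V (∑ c ∈ A i, s i c * F c) =
      IsLocalRing.residue V (F (a i)) + IsLocalRing.residue V (F (b i)) := by
  classical
  rw [map_sum, ← Finset.sum_subset (s₁ := {a i, b i}), Finset.sum_pair (h.hab i), h.sa, h.sb,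
    one_mul, one_mul]
  · intro c hc
    simp only [Finset.mem_insert, Finset.mem_singleton] at hc
    rcases hc with rfl | rfl
    · exact h.ha i
    · exact h.hb i
  · intro c hc hc2
    simp only [Finset.mem_insert, Finset.mem_singleton, not_or] at hc2
    rw [map_mul, (IsLocalRing.residue_eq_zero_iff _).2 (h.so i c hc hc2.1 hc2.2), zero_mul]

/-- reduction of points -/
noncomputable def redp (y : Fin n → Vˣ) : Fin n → (IsLocalRing.ResidueField V)ˣ :=
  fun j => Units.map (IsLocalRing.residue V : V →* IsLocalRing.ResidueField V) (y j)

lemma coe_mon_redp (y : Fin n → Vˣ) (c : Fin n → ℤ) :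
    ((mon (redp y) c : (IsLocalRing.ResidueField V)ˣ) : IsLocalRing.ResidueField V)
      = IsLocalRing.residue V ((mon y c : Vˣ) : V) := by
  unfold redp
  rw [mon_map]
  rfl

lemma Shape.sum_zero (h : Shape V A s a b) {y : Fin n → Vˣ} (hy : y ∈ Zr V A s) (i : Fin n) :
    IsLocalRing.residue V ((mon y (a i) : Vˣ) : V) +
      IsLocalRing.residue V ((mon y (b i) : Vˣ) : V) = 0 := by
  rw [← h.red i (fun c => ((mon y c : Vˣ) : V)), hy i, map_zero]

lemma Shape.redp_mem (h : Shape V A s a b) {y : Fin n → Vˣ} (hy : y ∈ Zr V A s) (i : Fin n) :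
    mon (redp y) ((dm a b) i) = -1 := by
  change mon (redp y) (a i - b i) = -1
  rw [mon_sub, div_eq_iff_eq_mul]
  ext
  rw [Units.val_mul, coe_mon_redp, coe_mon_redp]
  have := h.sum_zero hy i
  simp only [Units.val_neg, Units.val_one, neg_mul, one_mul]
  exact eq_neg_of_add_eq_zero_left this

lemma Shape.inj [CharZero (IsLocalRing.ResidueField V)] (h : Shape V A s a b)
    (hD : (dm a b).det ≠ 0) {y y' : Fin n → Vˣ} (hy : y ∈ Zr V A s) (hy' : y' ∈ Zr V A s)
    (hr : redp y = redp y') : y = y' := by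
  classical
  by_contra hne
  let ε : Fin n → V := fun j => (((y' j) * (y j)⁻¹ : Vˣ) : V) - 1
  have hε : ∀ j, ε j ∈ IsLocalRing.maximalIdeal V := by
    intro j
    rw [← IsLocalRing.residue_eq_zero_iff]
    have h1 : redp y j = redp y' j := congrFun hr j
    have h2 : Units.map (IsLocalRing.residue V : V →* IsLocalRing.ResidueField V)
        ((y' j) * (y j)⁻¹) = 1 := by
      rw [map_mul, map_inv]
      change redp y' j * (redp y j)⁻¹ = 1
      rw [h1, mul_inv_cancel]
    have h3 := congrArg Units.val h2
    simp only [ε, map_sub, map_one]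
    rw [sub_eq_zero]
    exact h3
  obtain ⟨j1, hj1⟩ : ∃ j, y j ≠ y' j := by
    by_contra! hcon
    exact hne (funext hcon)
  have hε1 : ε j1 ≠ 0 := by
    intro h0
    apply hj1
    have : (((y' j1) * (y j1)⁻¹ : Vˣ) : V) = 1 := sub_eq_zero.1 h0
    have h2 : (y' j1) * (y j1)⁻¹ = 1 := Units.ext this
    exact (mul_inv_eq_one.1 h2).symm
  obtain ⟨j0, -, hj0⟩ := Finset.exists_max_image Finset.univ
    (fun j => V.valuation (ε j : L)) ⟨j1, Finset.mem_univ _⟩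
  have hη : ∀ j, ∃ η : V, ε j = ε j0 * η := by
    intro j
    obtain ⟨c, hc⟩ := (V.valuation_le_iff _ _).1 (hj0 j (Finset.mem_univ _))
    exact ⟨c, Subtype.ext (by rw [mul_comm]; exact hc.symm)⟩
  choose η hη using hη
  set e := ε j0 with he
  have he0 : e ≠ 0 := by
    intro h0
    apply hε1
    rw [hη, h0, zero_mul]
  have hη0 : η j0 = 1 := by
    have := hη j0
    rw [← he] at this
    exact (mul_eq_left₀ he0).1 this.symm
  let z : Fin n → Vˣ := fun j => y' j * (y j)⁻¹
  have hz : ∀ j, (z j : V) = 1 + e * η j := by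
    intro j
    rw [← hη j]
    simp [ε, z]
  have hyz : y' = y * z := by
    ext j
    simp [z]
  have hexp := fun c => expand_mon (hε j0) hz c
  choose μ hμ hexp using hexp
  have hrow : ∀ i, ∑ j, ((dm a b i j : ℤ) : IsLocalRing.ResidueField V) *
      IsLocalRing.residue V (η j) = 0 := by
    intro i
    have h1 := hy i
    have h2 := hy' i
    have h3 : e * ∑ c ∈ A i, s i c * (((mon y c : Vˣ) : V) * (∑ j, (c j : V) * η j + μ c)) = 0 := by
      rw [← sub_eq_zero.2 (h2.trans h1.symm), Finset.mul_sum, ← Finset.sum_sub_distrib]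
      refine Finset.sum_congr rfl fun c _ => ?_
      rw [hyz, mon_mul, Units.val_mul, hexp]
      ring
    have h4 := (mul_eq_zero.1 h3).resolve_left he0
    have h5 := congrArg (IsLocalRing.residue V) h4
    rw [h.red i, map_zero] at h5
    have h6 := h.sum_zero hy i
    have hm : ∀ c, IsLocalRing.residue V (μ c) = 0 := fun c =>
      (IsLocalRing.residue_eq_zero_iff _).2 (hμ c)
    simp only [map_mul, map_add, hm, add_zero, map_sum, map_intCast] at h5
    rw [eq_neg_of_add_eq_zero_left h6] at h5
    have hu : IsLocalRing.residue V ((mon y (b i) : Vˣ) : V) ≠ 0 :=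
      (IsLocalRing.residue_ne_zero_iff_isUnit _).2 (Units.isUnit _)
    have h7 : ∑ j, ((dm a b i j : ℤ) : IsLocalRing.ResidueField V) * IsLocalRing.residue V (η j)
      = ∑ j, ((a i j : ℤ) : IsLocalRing.ResidueField V) * IsLocalRing.residue V (η j)
       - ∑ j, ((b i j : ℤ) : IsLocalRing.ResidueField V) * IsLocalRing.residue V (η j) := by
      rw [← Finset.sum_sub_distrib]
      refine Finset.sum_congr rfl fun j _ => ?_
      simp [dm]; ring
    rw [h7]
    refine (mul_eq_zero.1 ?_).resolve_left hu
    linear_combination -h5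
  have h0 := cramer (Γ := IsLocalRing.ResidueField V) hD (g := fun j => IsLocalRing.residue V (η j))
    (fun i => by simpa only [zsmul_eq_mul] using hrow i)
  have := congrFun h0 j0
  simp [hη0] at this

lemma Shape.count [CharZero (IsLocalRing.ResidueField V)] (h : Shape V A s a b)
    (hD : (dm a b).det ≠ 0) : (Zr V A s).Finite ∧ (Zr V A s).ncard ≤ (dm a b).det.natAbs := by
  obtain ⟨h1, h2⟩ := count_mono (κ := IsLocalRing.ResidueField V) hD (fun _ => -1)
  have hm : ∀ y ∈ Zr V A s, redp y ∈ {y : Fin n → (IsLocalRing.ResidueField V)ˣ |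
      ∀ i, mon y (dm a b i) = -1} := fun y hy i => h.redp_mem hy i
  have hinj : Set.InjOn redp (Zr V A s) := fun y hy y' hy' hr => h.inj hD hy hy' hr
  exact ⟨Set.Finite.of_injOn hm hinj h1, (Set.ncard_le_ncard_of_injOn _ hm hinj h1).trans h2⟩

end BKK

namespace BKK
variable {n : ℕ}

lemma two_max {L Γ : Type*} [Field L] [LinearOrderedCommGroupWithZero Γ] (v : Valuation L Γ)
    {ι : Type*} {A : Finset ι} (hA : A.Nonempty) {u : ι → L} (hu : ∀ c, u c ≠ 0)
    (h : ∑ c ∈ A, u c = 0) : ∃ a ∈ A, ∃ b ∈ A, a ≠ b ∧ v (u a) = v (u b) ∧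
      ∀ c ∈ A, v (u c) ≤ v (u a) := by
  classical
  obtain ⟨a, ha, hmax⟩ := A.exists_max_image (fun c => v (u c)) hA
  by_contra! hcon
  have : v (∑ c ∈ A, u c) = v (u a) := by
    refine v.map_sum_eq_of_lt ha fun c hc => ?_
    simp only [Finset.mem_sdiff, Finset.mem_singleton] at hc
    refine lt_of_le_of_ne (hmax c hc.1) fun he => ?_
    obtain ⟨d, hd, hd2⟩ := hcon a ha c hc.1 (Ne.symm hc.2) he.symm
    exact absurd (hmax d hd) (not_le.2 hd2)
  rw [h, map_zero] at this
  exact hu a ((map_eq_zero v).1 this.symm)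

section
variable {L : Type*} [Field L] (V : ValuationSubring L) (t : Multiplicative ℝ →* Lˣ)

/-- `t` of a real exponent -/
abbrev tt (r : ℝ) : Lˣ := t (Multiplicative.ofAdd r)

/-- value homomorphism -/
noncomputable def vT : ℝ →+ Additive (V.ValueGroup)ˣ :=
  MonoidHom.toAdditiveRight ((Units.map (V.valuation : L →* V.ValueGroup)).comp t)

/-- zero set over the big field -/
def ZL (A : Fin n → Finset (Fin n → ℤ)) (ω : Fin n → (Fin n → ℤ) → ℝ) : Set (Fin n → Lˣ) :=
  {x | ∀ i, ∑ c ∈ A i, (tt t (ω i c) : L) * ((mon x c : Lˣ) : L) = 0}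

lemma tt_add (r s : ℝ) : tt t (r + s) = tt t r * tt t s := by
  simp [tt, ofAdd_add]

lemma val_tt_lt (ht : ∀ r : ℝ, 0 < r → V.valuation (tt t r : L) < 1) {r s : ℝ} (h : r < s) :
    V.valuation (tt t s : L) < V.valuation (tt t r : L) := by
  have : tt t s = tt t (s - r) * tt t r := by rw [← tt_add]; congr 2; ring
  rw [this, Units.val_mul, map_mul]
  have h0 : 0 < V.valuation (tt t r : L) := zero_lt_iff.2 ((map_ne_zero _).2 (Units.ne_zero _))
  calc _ < 1 * V.valuation (tt t r : L) := by
        exact mul_lt_mul_of_pos_right (ht _ (sub_pos.2 h)) h0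
    _ = _ := one_mul _

lemma val_tt_le (ht : ∀ r : ℝ, 0 < r → V.valuation (tt t r : L) < 1) {r s : ℝ} :
    V.valuation (tt t s : L) ≤ V.valuation (tt t r : L) ↔ r ≤ s := by
  constructor
  · intro h
    by_contra! hcon
    exact absurd h (not_le.2 (val_tt_lt V t ht hcon))
  · intro h
    rcases h.lt_or_eq with h | rfl
    · exact (val_tt_lt V t ht h).le
    · exact le_rfl

lemma vT_inj (ht : ∀ r : ℝ, 0 < r → V.valuation (tt t r : L) < 1) :
    Function.Injective (vT V t) := by
  intro r s h
  have h1 : V.valuation (tt t r : L) = V.valuation (tt t s : L) := congrArg Units.val h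
  exact le_antisymm ((val_tt_le V t ht).1 h1.ge) ((val_tt_le V t ht).1 h1.le)

lemma mon_tt (w : Fin n → ℝ) (c : Fin n → ℤ) :
    mon (fun j => tt t (w j)) c = tt t (∑ j, (c j : ℝ) * w j) := by
  unfold tt
  rw [mon_map]
  congr 1
  simp [mon, ofAdd_sum, ← ofAdd_zsmul]

/-- value vector -/
noncomputable def gv (x : Fin n → Lˣ) : Fin n → Additive (V.ValueGroup)ˣ := fun j =>
  Additive.ofMul (Units.map (V.valuation : L →* V.ValueGroup) (x j))

lemma gh_gv (ω : Fin n → (Fin n → ℤ) → ℝ) (x : Fin n → Lˣ) (i : Fin n) (c : Fin n → ℤ) :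
    gh ω (vT V t) (gv V x) (i, c) =
      Additive.ofMul (Units.map (V.valuation : L →* V.ValueGroup) (tt t (ω i c) * mon x c)) := by
  simp only [gh, map_mul, ofMul_mul]
  congr 1
  rw [← mon_map]
  simp [mon, gv, ofMul_prod]

lemma exists_w {A : Fin n → Finset (Fin n → ℤ)} (hA : ∀ i, (A i).Nonempty)
    {ω : Fin n → (Fin n → ℤ) → ℝ} (hω : Gen ω)
    (ht : ∀ r : ℝ, 0 < r → V.valuation (tt t r : L) < 1) {x : Fin n → Lˣ} (hx : x ∈ ZL t A ω) :
    ∃ w : Fin n → ℝ, (∀ j, V.valuation (x j : L) = V.valuation (tt t (w j) : L)) ∧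
      ∃ a b : Fin n → Fin n → ℤ, (∀ i, a i ≠ b i) ∧ (∀ i, a i ∈ mins (A i) (ω i) w) ∧
      (∀ i, b i ∈ mins (A i) (ω i) w) := by
  have h1 := fun i => two_max V.valuation (hA i)
    (u := fun c => (tt t (ω i c) : L) * ((mon x c : Lˣ) : L))
    (fun c => mul_ne_zero (Units.ne_zero _) (Units.ne_zero _)) (hx i)
  choose a ha b hb hab hv hmax using h1
  have hg : ∀ i, gh ω (vT V t) (gv V x) (i, a i) = gh ω (vT V t) (gv V x) (i, b i) := by
    intro i
    rw [gh_gv, gh_gv]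
    congr 1
    ext
    exact hv i
  obtain ⟨w, hw⟩ := exists_real hω (vT_inj V t ht) (gv V x) hab hg
  have hw' : ∀ j, V.valuation (x j : L) = V.valuation (tt t (w j) : L) := fun j =>
    congrArg (fun z : Additive (V.ValueGroup)ˣ => (z.toMul : V.ValueGroup)) (hw j)
  have hval : ∀ i c, V.valuation ((tt t (ω i c) : L) * ((mon x c : Lˣ) : L)) =
      V.valuation (tt t (BKK.ht (ω i) w c) : L) := by
    intro i c
    have e1 : Units.map (V.valuation : L →* V.ValueGroup) (mon x c) =
        Units.map (V.valuation : L →* V.ValueGroup) (mon (fun j => tt t (w j)) c) := by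
      rw [← mon_map, ← mon_map]
      congr 1
      ext j
      exact hw' j
    have e2 : V.valuation ((mon x c : Lˣ) : L) = V.valuation ((mon (fun j => tt t (w j)) c : Lˣ) : L) :=
      congrArg Units.val e1
    rw [map_mul, e2, mon_tt, ← map_mul, ← Units.val_mul, ← tt_add]
    rfl
  simp only [hval] at hmax hv
  refine ⟨w, hw', a, b, hab, fun i => mem_mins.2 ⟨ha i, fun c hc => ?_⟩,
    fun i => mem_mins.2 ⟨hb i, fun c hc => ?_⟩⟩
  · exact (val_tt_le V t ht).1 (hmax i c hc)
  · exact (val_tt_le V t ht).1 ((hmax i c hc).trans (hv i).le)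

lemma count_w [CharZero (IsLocalRing.ResidueField V)] {A : Fin n → Finset (Fin n → ℤ)}
    {ω : Fin n → (Fin n → ℤ) → ℝ} (hω : Gen ω)
    (ht' : ∀ r : ℝ, 0 < r → V.valuation (tt t r : L) < 1) {w : Fin n → ℝ}
    {a b : Fin n → Fin n → ℤ} (hab : ∀ i, a i ≠ b i) (ha : ∀ i, a i ∈ mins (A i) (ω i) w)
    (hb : ∀ i, b i ∈ mins (A i) (ω i) w) :
    {x ∈ ZL t A ω | ∀ j, V.valuation (x j : L) = V.valuation (tt t (w j) : L)}.Finite ∧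
    ({x ∈ ZL t A ω | ∀ j, V.valuation (x j : L) = V.valuation (tt t (w j) : L)}.ncard : ℝ) ≤
      mv (fun i => mins (A i) (ω i) w) := by
  classical
  obtain ⟨hD, hmins⟩ := pairs_of hω hab ha hb
  have hmem : ∀ i c, c ∈ A i → (tt t (ht (ω i) w c - ht (ω i) w (a i)) : L) ∈ V := by
    intro i c hc
    rw [← V.valuation_le_one_iff, ← V.valuation.map_one]
    have : (1 : L) = (tt t 0 : L) := by simp [tt]
    rw [this, val_tt_le V t ht']
    exact sub_nonneg.2 ((mem_mins.1 (ha i)).2 c hc)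
  let s : Fin n → (Fin n → ℤ) → V := fun i c => if hc : c ∈ A i then
    ⟨(tt t (ht (ω i) w c - ht (ω i) w (a i)) : L), hmem i c hc⟩ else 1
  have hs : ∀ i c, c ∈ A i → (s i c : L) = (tt t (ht (ω i) w c - ht (ω i) w (a i)) : L) := by
    intro i c hc
    simp only [s, hc, dif_pos]
  have hA : ∀ i, a i ∈ A i := fun i => (mem_mins.1 (ha i)).1
  have hB : ∀ i, b i ∈ A i := fun i => (mem_mins.1 (hb i)).1
  have hshape : Shape V A s a b := by
    refine ⟨hA, hB, hab, fun i => ?_, fun i => ?_, fun i c hc hca hcb => ?_⟩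
    · apply Subtype.ext
      rw [hs i _ (hA i)]
      simp [tt]
    · apply Subtype.ext
      rw [hs i _ (hB i), ht_eq_of_mins (hb i) (ha i)]
      simp [tt]
    · rw [V.valuation_lt_one_iff, hs i c hc]
      apply ht'
      rw [sub_pos]
      refine lt_of_le_of_ne ((mem_mins.1 (ha i)).2 c hc) fun he => ?_
      have : c ∈ mins (A i) (ω i) w :=
        mem_mins.2 ⟨hc, fun d hd => he ▸ (mem_mins.1 (ha i)).2 d hd⟩
      rw [hmins i] at this
      simp only [Finset.mem_insert, Finset.mem_singleton] at this
      tauto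
  obtain ⟨hf, hle⟩ := hshape.count hD
  let Ψ : (Fin n → Vˣ) → (Fin n → Lˣ) := fun y j =>
    Units.map (V.subtype : V →* L) (y j) * tt t (w j)
  have hsub : {x ∈ ZL t A ω | ∀ j, V.valuation (x j : L) = V.valuation (tt t (w j) : L)} ⊆
      Ψ '' (Zr V A s) := by
    rintro x ⟨hx, hxw⟩
    have h1 := fun j => (V.valuation_eq_iff _ _).1 (hxw j)
    choose y hy using h1
    have hΨ : Ψ y = x := by
      ext j
      exact hy j
    refine ⟨y, fun i => ?_, hΨ⟩
    apply Subtype.ext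
    have hx' := hx i
    rw [← hΨ] at hx'
    have hmon : ∀ c, mon (Ψ y) c =
        Units.map (V.subtype : V →* L) (mon y c) * tt t (∑ j, (c j : ℝ) * w j) := by
      intro c
      rw [← mon_map, ← mon_tt, ← mon_mul]
      rfl
    have key : (tt t (- ht (ω i) w (a i)) : L) *
        ∑ c ∈ A i, (tt t (ω i c) : L) * ((mon (Ψ y) c : Lˣ) : L) = 0 := by rw [hx', mul_zero]
    rw [Finset.mul_sum] at key
    change V.subtype _ = V.subtype 0
    rw [map_sum, map_zero, ← key]
    refine Finset.sum_congr rfl fun c hc => ?_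
    rw [map_mul]
    change (s i c : L) * _ = _
    rw [hs i c hc, hmon, sub_eq_add_neg, tt_add, ht, tt_add]
    simp only [Units.val_mul, Units.coe_map, MonoidHom.coe_coe]
    ring
  have hf2 := hf.image Ψ
  refine ⟨hf2.subset hsub, ?_⟩
  rw [mv_pairs hmins]
  have h3 := (Set.ncard_le_ncard hsub hf2).trans ((Set.ncard_image_le hf).trans hle)
  calc _ ≤ (((dm a b).det.natAbs : ℕ) : ℝ) := by exact_mod_cast h3
    _ = _ := by rw [Nat.cast_natAbs, Int.cast_abs]; rfl

theorem count_L [CharZero (IsLocalRing.ResidueField V)] {A : Fin n → Finset (Fin n → ℤ)}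
    (hA : ∀ i, (A i).Nonempty) {ω : Fin n → (Fin n → ℤ) → ℝ} (hω : Gen ω)
    (ht' : ∀ r : ℝ, 0 < r → V.valuation (tt t r : L) < 1) :
    (ZL t A ω).Finite ∧ ((ZL t A ω).ncard : ℝ) ≤ mv A := by
  classical
  obtain ⟨W, hW⟩ := exists_reps A ω
  let good : (Fin n → ℝ) → Prop := fun w => ∃ a b : Fin n → Fin n → ℤ, (∀ i, a i ≠ b i) ∧
    (∀ i, a i ∈ mins (A i) (ω i) w) ∧ (∀ i, b i ∈ mins (A i) (ω i) w)
  let X : (Fin n → ℝ) → Set (Fin n → Lˣ) := fun w =>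
    {x ∈ ZL t A ω | ∀ j, V.valuation (x j : L) = V.valuation (tt t (w j) : L)}
  have hsub : ZL t A ω ⊆ ⋃ w ∈ W.filter good, X w := by
    intro x hx
    obtain ⟨w, hw, a, b, hab, ha, hb⟩ := exists_w V t hA hω ht' hx
    obtain ⟨w', hw', hm⟩ := hW w
    have : w = w' := w_unique hω hab ha hb (fun i => hm i ▸ ha i) (fun i => hm i ▸ hb i)
    subst this
    exact Set.mem_iUnion₂.2 ⟨w, Finset.mem_filter.2 ⟨hw', a, b, hab, ha, hb⟩, hx, hw⟩
  have hX : ∀ w ∈ W.filter good, (X w).Finite ∧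
      ((X w).ncard : ℝ) ≤ mv (fun i => mins (A i) (ω i) w) := by
    intro w hw
    obtain ⟨-, a, b, hab, ha, hb⟩ := Finset.mem_filter.1 hw
    exact count_w V t hω ht' hab ha hb
  have hfin : (⋃ w ∈ W.filter good, X w).Finite :=
    Set.Finite.biUnion (Finset.finite_toSet _) fun w hw => (hX w hw).1
  refine ⟨hfin.subset hsub, ?_⟩
  have hmv : mv A = ∑ w ∈ W.filter good, mv (fun i => mins (A i) (ω i) w) := by
    rw [mv_sum hA ω W hW, ← Finset.sum_subset (Finset.filter_subset good W)]
    intro w hw hng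
    have hng : ¬ good w := fun h => hng (Finset.mem_filter.2 ⟨hw, h⟩)
    obtain ⟨i, hi⟩ : ∃ i, ¬ ∃ a b, a ≠ b ∧ a ∈ mins (A i) (ω i) w ∧ b ∈ mins (A i) (ω i) w := by
      by_contra! hcon
      choose a b hab using hcon
      exact hng ⟨a, b, fun i => (hab i).1, fun i => (hab i).2.1, fun i => (hab i).2.2⟩
    obtain ⟨a, ha⟩ := mins_nonempty (hA i) (ω i) w
    refine mv_eq_zero (i := i) (a := a) ?_
    ext c
    rw [Finset.mem_singleton]
    constructor
    · intro hc
      by_contra hne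
      exact hi ⟨c, a, hne, hc, ha⟩
    · rintro rfl; exact ha
  rw [hmv]
  calc ((ZL t A ω).ncard : ℝ) ≤ ((⋃ w ∈ W.filter good, X w).ncard : ℝ) := by
        exact_mod_cast Set.ncard_le_ncard hsub hfin
    _ ≤ ∑ w ∈ W.filter good, ((X w).ncard : ℝ) := by
        have : (⋃ w ∈ W.filter good, X w).ncard ≤ ∑ w ∈ W.filter good, (X w).ncard :=
          Finset.set_ncard_biUnion_le _ _
        exact_mod_cast this
    _ ≤ _ := Finset.sum_le_sum fun w hw => (hX w hw).2

end
end BKK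

namespace BKK

/-- Hahn monomials -/
noncomputable def hs : Multiplicative ℝ →* HahnSeries ℝ ℂ where
  toFun r := HahnSeries.single r.toAdd 1
  map_one' := rfl
  map_mul' a b := by simp

lemma hC (z : ℂ) : algebraMap ℂ (HahnSeries ℝ ℂ) z = HahnSeries.single 0 z := by
  rw [HahnSeries.algebraMap_apply']
  simp

lemma hs_algInd {ι : Type*} (θ : ι → ℝ) (h : LinearIndependent ℤ θ) :
    AlgebraicIndependent ℂ (fun i => hs (Multiplicative.ofAdd (θ i))) := by
  classical
  rw [algebraicIndependent_iff]
  intro p hp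
  rw [MvPolynomial.aeval_def, MvPolynomial.eval₂_eq] at hp
  let E : (ι →₀ ℕ) → ℝ := fun d => d.sum (fun i k => k • θ i)
  have hE : Function.Injective E := by
    intro d d' hdd
    have h1 : ∀ d : ι →₀ ℕ, E d =
        Finsupp.linearCombination ℤ θ (d.mapRange (fun k : ℕ => (k : ℤ)) rfl) := by
      intro d
      rw [Finsupp.linearCombination_apply, Finsupp.sum_mapRange_index (by simp)]
      simp [E]
    rw [h1, h1] at hdd
    have h2 := h hdd
    ext i
    have := DFunLike.congr_fun h2 i
    simpa using this
  have hm : ∀ d : ι →₀ ℕ, ∏ i ∈ d.support, (hs (Multiplicative.ofAdd (θ i))) ^ d i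
      = HahnSeries.single (E d) 1 := by
    intro d
    have : ∏ i ∈ d.support, (hs (Multiplicative.ofAdd (θ i))) ^ d i
      = hs (∏ i ∈ d.support, (Multiplicative.ofAdd (θ i)) ^ d i) := by
      simp
    rw [this]
    change HahnSeries.single _ 1 = _
    congr 1
  ext d
  rw [MvPolynomial.coeff_zero]
  by_contra hd
  have hds : d ∈ p.support := MvPolynomial.mem_support_iff.2 hd
  have := congrArg (fun x : HahnSeries ℝ ℂ => x.coeff (E d)) hp
  simp only [hm] at this
  rw [HahnSeries.coeff_sum, Finset.sum_eq_single d] at this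
  · rw [hC] at this
    simp at this
    exact hd this
  · intro b _ hb
    rw [hC]
    simp [HahnSeries.coeff_single_of_ne (fun h => hb (hE h).symm)]
  · exact fun h => absurd hds h

lemma exists_valued : ∃ (L : Type) (_ : Field L) (_ : Algebra ℂ L) (_ : IsAlgClosed L)
    (V : ValuationSubring L) (t : Multiplicative ℝ →* Lˣ),
    (∀ z : ℂ, algebraMap ℂ L z ∈ V) ∧
    (∀ r : ℝ, 0 < r → V.valuation (t (Multiplicative.ofAdd r)) < 1) ∧
    ∀ (ι : Type) (θ : ι → ℝ), LinearIndependent ℤ θ →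
      AlgebraicIndependent ℂ (fun i => (t (Multiplicative.ofAdd (θ i)) : L)) := by
  let H := HahnSeries ℝ ℂ
  let L := AlgebraicClosure H
  let R : Subring H :=
    { carrier := {x | 0 ≤ x.orderTop}
      mul_mem' := by
        intro x y hx hy
        have := (HahnSeries.addVal ℝ ℂ).map_mul x y
        simp only [HahnSeries.addVal_apply] at this
        change 0 ≤ (x * y).orderTop
        rw [this]; exact add_nonneg hx hy
      one_mem' := by simp
      add_mem' := by
        intro x y hx hy
        have h1 : min x.orderTop y.orderTop ≤ (x + y).orderTop :=
          HahnSeries.min_orderTop_le_orderTop_add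
        exact le_trans (le_min hx hy) h1
      zero_mem' := by simp
      neg_mem' := by
        intro x hx
        have h1 : (-x).orderTop = x.orderTop := HahnSeries.orderTop_neg
        change 0 ≤ (-x).orderTop
        rw [h1]; exact hx }
  have hR : ∀ x : H, x ∈ R ↔ 0 ≤ x.orderTop := fun x => Iff.rfl
  have hunit : ∀ x : R, IsUnit x ↔ (x : H).orderTop = 0 := by
    intro x
    constructor
    · rintro ⟨u, rfl⟩
      have h1 : ((u : R) : H) * ((u⁻¹ : Rˣ) : R) = 1 := by
        rw [← Subring.coe_mul]; simp
      have h2 := (HahnSeries.addVal ℝ ℂ).map_mul ((u : R) : H) ((u⁻¹ : Rˣ) : R)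
      rw [h1] at h2
      simp only [HahnSeries.addVal_apply, HahnSeries.orderTop_one] at h2
      have h3 := (hR _).1 (u : R).2
      have h4 := (hR _).1 ((u⁻¹ : Rˣ) : R).2
      exact ((add_eq_zero_iff_of_nonneg h3 h4).1 h2.symm).1
    · intro hx
      have hx0 : (x : H) ≠ 0 := by
        intro h; rw [h] at hx; simp at hx
      have h2 := (HahnSeries.addVal ℝ ℂ).map_mul (x : H) (x : H)⁻¹
      rw [mul_inv_cancel₀ hx0] at h2
      simp only [HahnSeries.addVal_apply, HahnSeries.orderTop_one, hx, zero_add] at h2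
      exact IsUnit.of_mul_eq_one ⟨(x : H)⁻¹, (hR _).2 h2.le⟩ (Subtype.ext (mul_inv_cancel₀ hx0))
  have : IsLocalRing R := by
    refine IsLocalRing.of_nonunits_add ?_
    intro a b ha hb
    simp only [mem_nonunits_iff, hunit] at *
    have ha' := lt_of_le_of_ne ((hR _).1 a.2) (Ne.symm ha)
    have hb' := lt_of_le_of_ne ((hR _).1 b.2) (Ne.symm hb)
    have : min (a : H).orderTop (b : H).orderTop ≤ ((a + b : R) : H).orderTop :=
      HahnSeries.min_orderTop_le_orderTop_add
    exact ((lt_min ha' hb').trans_le this).ne'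
  obtain ⟨V, hV, hloc⟩ := IsLocalRing.exists_factor_valuationRing
    ((algebraMap H L).comp R.subtype)
  let t : Multiplicative ℝ →* Lˣ := MonoidHom.toHomUnits ((algebraMap H L : H →* L).comp hs)
  have ht : ∀ r, (t r : L) = algebraMap H L (hs r) := fun r => rfl
  refine ⟨L, inferInstance, inferInstance, inferInstance, V, t, ?_, ?_, ?_⟩
  · intro z
    rw [IsScalarTower.algebraMap_apply ℂ H L]
    refine hV ⟨algebraMap ℂ H z, ?_⟩
    rw [hR, hC]
    by_cases hz : z = 0
    · simp [hz]
    · simp [hz]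
  · intro r hr
    have ho : (hs (Multiplicative.ofAdd r)).orderTop = r := by
      change (HahnSeries.single r (1 : ℂ)).orderTop = r
      simp
    let x : R := ⟨hs (Multiplicative.ofAdd r), by
      rw [hR, ho]; exact_mod_cast hr.le⟩
    have hx : ¬ IsUnit x := by
      rw [hunit]
      change (hs (Multiplicative.ofAdd r)).orderTop ≠ 0
      rw [ho]; exact_mod_cast hr.ne'
    have hx2 : ¬ IsUnit ((((algebraMap H L).comp R.subtype).codRestrict V.toSubring hV) x) :=
      fun h => hx (hloc.1 _ h)
    have h3 := (V.valuation_lt_one_iff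
      ((((algebraMap H L).comp R.subtype).codRestrict V.toSubring hV) x)).1 ?_
    · exact h3
    · exact (IsLocalRing.mem_maximalIdeal _).2 hx2
  · intro ι θ hθ
    exact (hs_algInd θ hθ).map' (f := IsScalarTower.toAlgHom ℂ H L)
      (FaithfulSMul.algebraMap_injective H L)

end BKK

namespace BKK

section abstractPart

variable {k S B : Type} [Field k] [IsAlgClosed k] [CommRing S] [CommRing B] [Algebra k S]
  [Algebra k B] [Algebra S B] [IsScalarTower k S B]

lemma exists_hom_of_isMaximal [Algebra.FiniteType k B] (m : Ideal B) [hm : m.IsMaximal] :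
    ∃ φ : B →ₐ[k] k, RingHom.ker φ = m := by
  let := Ideal.Quotient.field m
  have : Module.Finite k (B ⧸ m) := finite_of_finite_type_of_isJacobsonRing k (B ⧸ m)
  have hb : Function.Bijective (algebraMap k (B ⧸ m)) :=
    IsAlgClosed.algebraMap_bijective_of_isIntegral
  let e : k ≃ₐ[k] (B ⧸ m) := AlgEquiv.ofBijective (Algebra.ofId k (B ⧸ m)) hb
  refine ⟨(e.symm : (B ⧸ m) →ₐ[k] k).comp (Ideal.Quotient.mkₐ k m), ?_⟩
  ext x
  simp [RingHom.mem_ker, Ideal.Quotient.eq_zero_iff_mem]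

lemma hom_eq_of_ker_le {C : Type} [CommRing C] [Algebra k C] (φ ψ : C →ₐ[k] k)
    (h : RingHom.ker φ ≤ RingHom.ker ψ) : φ = ψ := by
  ext x
  have : x - algebraMap k C (φ x) ∈ RingHom.ker φ := by simp [RingHom.mem_ker]
  have := h this
  simp only [RingHom.mem_ker, map_sub, AlgHom.commutes, sub_eq_zero] at this
  simpa using this.symm

/-- points of the fibre -/
def Fib (k S B : Type) [Field k] [CommRing S] [CommRing B] [Algebra k S]
    [Algebra k B] [Algebra S B] (ev0 : S →ₐ[k] k) : Set (B →ₐ[k] k) :=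
  {φ | ∀ s : S, φ (algebraMap S B s) = ev0 s}

lemma prime_over [Algebra.FiniteType k B] (ev0 : S →ₐ[k] k) (hE : (Fib k S B ev0).Finite)
    (q : Ideal B) [q.IsPrime] (hq : q.comap (algebraMap S B) = RingHom.ker ev0) :
    ∃ φ ∈ Fib k S B ev0, RingHom.ker φ = q := by
  have hJ : IsJacobsonRing B := isJacobsonRing_of_finiteType (A := k)
  have h1 := hJ.out (Ideal.IsPrime.isRadical (inferInstance : q.IsPrime))
  have key : ∀ m : Ideal B, m.IsMaximal → q ≤ m → ∃ φ ∈ Fib k S B ev0, RingHom.ker φ = m := by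
    intro m hm hqm
    obtain ⟨φ, hφ⟩ := exists_hom_of_isMaximal (k := k) m
    refine ⟨φ, ?_, hφ⟩
    have := hom_eq_of_ker_le ev0 (φ.comp (IsScalarTower.toAlgHom k S B)) (by
      rw [← hq]
      intro s hs
      have h2 : algebraMap S B s ∈ RingHom.ker φ := hφ ▸ hqm hs
      simpa [RingHom.mem_ker] using h2)
    intro s
    rw [this]; simp
  have h2 : hE.toFinset.inf (fun φ => RingHom.ker φ) ⊓ ⊤ ≤ (⊥ : Ideal B) ⊔ ⊤ := by simp
  by_cases hc : ∃ φ ∈ Fib k S B ev0, q = RingHom.ker φ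
  · obtain ⟨φ, h, h'⟩ := hc; exact ⟨φ, h, h'.symm⟩
  exfalso
  push Not at hc
  classical
  let F := hE.toFinset.filter (fun φ => q ≤ RingHom.ker φ)
  have h3 : F.inf (fun φ => RingHom.ker φ) ≤ q := by
    conv_rhs => rw [← h1]
    refine le_sInf ?_
    rintro m ⟨hm1, hm2⟩
    obtain ⟨φ, h, rfl⟩ := key m hm2 hm1
    exact Finset.inf_le (f := fun φ : B →ₐ[k] k => RingHom.ker φ) (by simp [F, h, hm1])
  rw [Ideal.IsPrime.inf_le' inferInstance] at h3
  obtain ⟨φ, h, h'⟩ := h3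
  simp only [F, Finset.mem_filter, Set.Finite.mem_toFinset] at h
  exact hc φ h.1 (le_antisymm h.2 h')

lemma zmt [Algebra.FiniteType k B] (ev0 : S →ₐ[k] k) (hE : (Fib k S B ev0).Finite)
    (φ : B →ₐ[k] k) (hφ : φ ∈ Fib k S B ev0) :
    ∃ r : B, φ r ≠ 0 ∧ IsIntegral S r ∧ ∀ x, ∃ m, IsIntegral S (r ^ m * x) := by
  have : Algebra.FiniteType S B := Algebra.FiniteType.of_restrictScalars_finiteType k S B
  have hp : (RingHom.ker φ).IsPrime := RingHom.ker_isPrime _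
  let q : PrimeSpectrum B := ⟨RingHom.ker φ, hp⟩
  have hker : ∀ φ ∈ Fib k S B ev0, (RingHom.ker φ).comap (algebraMap S B) = RingHom.ker ev0 := by
    intro φ h
    ext s
    simp [RingHom.mem_ker, h s]
  have hcl : ∀ p : PrimeSpectrum.comap (algebraMap S B) ⁻¹' {q.comap (algebraMap S B)},
      ∃ φ ∈ Fib k S B ev0, RingHom.ker φ = p.1.asIdeal := by
    intro p
    have := p.2
    simp only [Set.mem_preimage, Set.mem_singleton_iff] at this
    have h1 := congrArg PrimeSpectrum.asIdeal this
    have h2 : p.1.asIdeal.comap (algebraMap S B) = RingHom.ker ev0 := by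
      rw [← hker φ hφ]; exact h1
    exact prime_over ev0 hE p.1.asIdeal h2
  have hfin : Finite (PrimeSpectrum.comap (algebraMap S B) ⁻¹' {q.comap (algebraMap S B)}) := by
    have : Finite (Fib k S B ev0) := hE
    choose F hF1 hF2 using hcl
    refine Finite.of_injective (fun p => (⟨F p, hF1 p⟩ : Fib k S B ev0)) ?_
    intro p p' h
    have h3 : F p = F p' := congrArg Subtype.val h
    apply Subtype.ext
    apply PrimeSpectrum.ext
    rw [← hF2, ← hF2, h3]
  have hT1 : T1Space (PrimeSpectrum.comap (algebraMap S B) ⁻¹' {q.comap (algebraMap S B)}) := by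
    refine ⟨fun p => ?_⟩
    obtain ⟨ψ, h1, h2⟩ := hcl p
    have hm : (RingHom.ker ψ).IsMaximal := RingHom.ker_isMaximal_of_surjective _
      (fun x => ⟨algebraMap k B x, by simp⟩)
    rw [h2] at hm
    have h4 := (PrimeSpectrum.isClosed_singleton_iff_isMaximal p.1).2 hm
    have h5 := h4.preimage (continuous_subtype_val (p := fun x => x ∈
      PrimeSpectrum.comap (algebraMap S B) ⁻¹' {q.comap (algebraMap S B)}))
    convert h5
    ext x; simp [Subtype.ext_iff]
  have : Algebra.QuasiFiniteAt S q.asIdeal :=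
    Algebra.QuasiFiniteAt.of_isOpen_singleton_fiber q (isOpen_discrete _)
  have := Algebra.ZariskisMainProperty.of_finiteType (R := S) q.asIdeal
  rw [Algebra.zariskisMainProperty_iff] at this
  obtain ⟨r, h1, h2, h3⟩ := this
  exact ⟨r, by simpa [q, RingHom.mem_ker] using h1, h2, h3⟩

end abstractPart

end BKK

namespace BKK

section abstractPart2

variable {k S B : Type} [Field k] [IsAlgClosed k] [CommRing S] [CommRing B] [Algebra k S]
  [Algebra k B] [Algebra S B] [IsScalarTower k S B]

lemma exists_sep [Algebra.FiniteType k B] (ev0 : S →ₐ[k] k) (hE : (Fib k S B ev0).Finite) :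
    ∃ h : B, IsIntegral S h ∧ Set.InjOn (fun φ : B →ₐ[k] k => φ h) (Fib k S B ev0) := by
  have : Finite (Fib k S B ev0) := hE
  let I := {p : Fib k S B ev0 × Fib k S B ev0 // p.1 ≠ p.2}
  let p : Submodule k B := Submodule.restrictScalars k (integralClosure S B).toSubmodule
  let F : I → Module.Dual k B := fun p => p.1.1.1.toLinearMap - p.1.2.1.toLinearMap
  have : Infinite k := IsAlgClosed.instInfinite
  obtain ⟨h, h1, h2⟩ := Module.Dual.exists_forall_mem_ne_zero_of_forall_exists p F (by
    rintro ⟨⟨⟨φ, hφ⟩, ⟨ψ, hψ⟩⟩, hne⟩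
    have hne' : φ ≠ ψ := fun h => hne (Subtype.ext h)
    obtain ⟨r, hr, hri, hx⟩ := zmt ev0 hE φ hφ
    by_cases hc : φ r = ψ r
    · obtain ⟨x, hx'⟩ : ∃ x, φ x ≠ ψ x := by
        by_contra hcon; push Not at hcon
        exact hne' (AlgHom.ext hcon)
      obtain ⟨m, hm⟩ := hx x
      refine ⟨r ^ m * x, hm, ?_⟩
      simp only [F, LinearMap.sub_apply, AlgHom.toLinearMap_apply, map_mul, map_pow, ← hc]
      rw [← mul_sub]
      exact mul_ne_zero (pow_ne_zero _ hr) (sub_ne_zero.2 hx')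
    · refine ⟨r, hri, ?_⟩
      simpa [F, sub_ne_zero] using hc)
  refine ⟨h, h1, ?_⟩
  intro φ hφ ψ hψ he
  by_contra hne
  refine h2 ⟨⟨⟨φ, hφ⟩, ⟨ψ, hψ⟩⟩, fun h => hne (congrArg Subtype.val h)⟩ ?_
  simpa [F, sub_eq_zero] using he

lemma alg_of_zmt {B C : Type} [CommRing C] [CommRing B] [IsDomain C] [IsDomain B] [Algebra C B]
    [FaithfulSMul C B]
    (r : B) (hr : r ≠ 0) (hri : IsIntegral C r) (hx : ∀ x, ∃ m, IsIntegral C (r ^ m * x)) :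
    Algebra.IsAlgebraic C B := by
  refine ⟨fun x => ?_⟩
  obtain ⟨m, hm⟩ := hx x
  let K := FractionRing C
  let F := FractionRing B
  have : FaithfulSMul C F := by
    rw [faithfulSMul_iff_algebraMap_injective, IsScalarTower.algebraMap_eq C B F]
    exact (FaithfulSMul.algebraMap_injective B F).comp (FaithfulSMul.algebraMap_injective C B)
  have h1 : IsAlgebraic C (algebraMap B F (r ^ m * x)) := hm.isAlgebraic.algebraMap
  have h2 : IsAlgebraic C (algebraMap B F (r ^ m)) := (hri.pow m).isAlgebraic.algebraMap
  have h3 := h2.inv.mul h1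
  have hr' : algebraMap B F r ≠ 0 := by
    simpa using hr
  have : (algebraMap B F (r ^ m))⁻¹ * algebraMap B F (r ^ m * x) = algebraMap B F x := by
    simp only [map_mul, map_pow]
    rw [← mul_assoc, inv_mul_cancel₀ (pow_ne_zero _ hr'), one_mul]
  rw [this] at h3
  exact (isAlgebraic_algebraMap_iff (FaithfulSMul.algebraMap_injective B F)).1 h3

theorem lift_count [CharZero k] [IsDomain S] [IsDomain B] [IsIntegrallyClosed S] [FaithfulSMul S B]
    [Algebra.FiniteType k B] (ev0 : S →ₐ[k] k) (hE : (Fib k S B ev0).Finite)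
    {L : Type} [Field L] [IsAlgClosed L] (σ : S →+* L) (hσ : Function.Injective σ) :
    ∃ T : Finset (B →+* L), (∀ ψ ∈ T, ∀ s, ψ (algebraMap S B s) = σ s) ∧
      (Fib k S B ev0).ncard ≤ T.card := by
  classical
  rcases (Fib k S B ev0).eq_empty_or_nonempty with he | ⟨φ0, hφ0⟩
  · exact ⟨∅, by simp, by simp [he]⟩
  obtain ⟨h, hi, hinj⟩ := exists_sep ev0 hE
  obtain ⟨r, hr, hri, hx⟩ := zmt ev0 hE φ0 hφ0
  have hr0 : r ≠ 0 := by rintro rfl; simp at hr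
  have halg : Algebra.IsAlgebraic S B := alg_of_zmt r hr0 hri hx
  let K := FractionRing S
  let F := FractionRing B
  have : FaithfulSMul S F := by
    rw [faithfulSMul_iff_algebraMap_injective, IsScalarTower.algebraMap_eq S B F]
    exact (FaithfulSMul.algebraMap_injective B F).comp (FaithfulSMul.algebraMap_injective S B)
  let : Algebra K F := FractionRing.liftAlgebra S F
  have : IsScalarTower S K F := FractionRing.isScalarTower_liftAlgebra S F
  have h1 : Algebra.IsAlgebraic S F := (IsFractionRing.isAlgebraic_iff' S B F).1 halg
  have h2 : Algebra.IsAlgebraic K F := (IsFractionRing.comap_isAlgebraic_iff (A := S)).1 h1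
  let : Algebra K L := (IsFractionRing.lift hσ : K →+* L).toAlgebra
  have hKL : ∀ s : S, algebraMap K L (algebraMap S K s) = σ s := by
    intro s
    exact IsFractionRing.lift_algebraMap hσ s
  have hz : algebraMap k S (0:k) = 0 := map_zero _
  have : CharZero K := by
    have : CharZero S := charZero_of_injective_algebraMap (algebraMap k S).injective
    exact charZero_of_injective_algebraMap (FaithfulSMul.algebraMap_injective S K)
  have hroot := Algebra.IsAlgebraic.range_eval_eq_rootSet_minpoly (F := K) L (algebraMap B F h)
  have hmp := minpoly.isIntegrallyClosed_eq_field_fractions K F hi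
  have hKi : IsIntegral K (algebraMap B F h) := (h2.isAlgebraic _).isIntegral
  have hsep : (minpoly K (algebraMap B F h)).Separable := (minpoly.irreducible hKi).separable
  have hcard := Polynomial.card_rootSet_eq_natDegree (K := L) hsep (IsAlgClosed.splits _)
  have hdeg : (minpoly K (algebraMap B F h)).natDegree = (minpoly S h).natDegree := by
    rw [hmp, Polynomial.natDegree_map_eq_of_injective (FaithfulSMul.algebraMap_injective S K)]
  have hch : ∀ y : (minpoly K (algebraMap B F h)).rootSet L, ∃ ψ : F →ₐ[K] L,
      ψ (algebraMap B F h) = y := by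
    rintro ⟨y, hy⟩
    rw [← hroot] at hy
    exact hy
  choose Ψ hΨ using hch
  let G : (minpoly K (algebraMap B F h)).rootSet L → (B →+* L) :=
    fun y => (Ψ y : F →+* L).comp (algebraMap B F)
  have hG : Function.Injective G := by
    intro y y' hy
    apply Subtype.ext
    rw [← hΨ, ← hΨ]
    exact congrArg (fun ψ : B →+* L => ψ h) hy
  refine ⟨Finset.univ.image G, ?_, ?_⟩
  · intro ψ hψ s
    simp only [Finset.mem_image, Finset.mem_univ, true_and] at hψ
    obtain ⟨y, rfl⟩ := hψ
    change Ψ y (algebraMap B F (algebraMap S B s)) = σ s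
    rw [← IsScalarTower.algebraMap_apply S B F, IsScalarTower.algebraMap_apply S K F,
      AlgHom.commutes, hKL]
  · rw [Finset.card_image_of_injective _ hG, Finset.card_univ, hcard, hdeg]
    have hmonic := minpoly.monic hi
    set P := (minpoly S h).map (ev0 : S →+* k) with hP
    have hP0 : P.Monic := hmonic.map _
    have hsub : (fun φ : B →ₐ[k] k => φ h) '' (Fib k S B ev0) ⊆ (P.roots.toFinset : Set k) := by
      rintro _ ⟨φ, hφ, rfl⟩
      rw [Finset.mem_coe, Multiset.mem_toFinset, Polynomial.mem_roots hP0.ne_zero,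
        Polynomial.IsRoot.def, hP, Polynomial.eval_map]
      have h3 : Polynomial.aeval h (minpoly S h) = 0 := minpoly.aeval S h
      have h4 := congrArg φ h3
      rw [Polynomial.aeval_def, map_zero] at h4
      have h5 := Polynomial.hom_eval₂ (minpoly S h) (algebraMap S B) (φ : B →+* k) h
      have h6 : (φ : B →+* k).comp (algebraMap S B) = (ev0 : S →+* k) := RingHom.ext hφ
      rw [h6] at h5
      rw [← h4]
      exact h5.symm
    rw [← hinj.ncard_image]
    calc _ ≤ (P.roots.toFinset : Set k).ncard := Set.ncard_le_ncard hsub (Finset.finite_toSet _)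
      _ = P.roots.toFinset.card := Set.ncard_coe_finset _
      _ ≤ P.roots.card := Multiset.toFinset_card_le _
      _ ≤ P.natDegree := P.card_roots'
      _ = _ := hmonic.natDegree_map _

end abstractPart2

end BKK

namespace BKK

variable {n : ℕ}

/-- Laurent polynomials -/
abbrev LR (n : ℕ) := AddMonoidAlgebra ℂ (Fin n → ℤ)

/-- cast exponent vectors -/
def castHom (n : ℕ) : (Fin n →₀ ℕ) →+ (Fin n → ℤ) where
  toFun d j := d j
  map_zero' := by ext; simp
  map_add' a b := by ext; simp

lemma castHom_inj (n : ℕ) : Function.Injective (castHom n) := by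
  intro a b h
  ext j
  have := congrFun h j
  simpa [castHom] using this

lemma algInd_x (n : ℕ) : AlgebraicIndependent ℂ
    (fun j : Fin n => (AddMonoidAlgebra.single (Pi.single j 1) 1 : LR n)) := by
  let φ : MvPolynomial (Fin n) ℂ →ₐ[ℂ] LR n :=
    AddMonoidAlgebra.mapDomainAlgHom ℂ ℂ (castHom n)
  have hφ : Function.Injective φ := by
    intro p q h
    exact AddMonoidAlgebra.mapDomain_injective (castHom_inj n) h
  rw [algebraicIndependent_iff_injective_aeval]
  have : MvPolynomial.aeval (fun j : Fin n => (AddMonoidAlgebra.single (Pi.single j 1) 1 : LR n))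
      = φ := by
    apply MvPolynomial.algHom_ext
    intro j
    rw [MvPolynomial.aeval_X]
    have h1 : φ (MvPolynomial.X j) = AddMonoidAlgebra.single (castHom n (Finsupp.single j 1)) 1 :=
      AddMonoidAlgebra.mapDomain_single
    rw [h1]
    congr 1
    ext i
    simp [castHom, Finsupp.single_apply, Pi.single_apply, eq_comm]
  rw [this]
  exact hφ

/-- negation -/
def ngg {R : Type} [CommRing R] (x : R) : R := -x

lemma ngg_add {R : Type} [CommRing R] (x y z : R) : ngg x * y + z = 0 ↔ x * y = z := by
  rw [ngg, neg_mul, neg_add_eq_zero]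

section conc

variable (A : Fin n → Finset (Fin n → ℤ)) (a0 : Fin n → (Fin n → ℤ))

/-- all coefficient indices -/
abbrev Idx := {p : Fin n × (Fin n → ℤ) // p.2 ∈ A p.1}

/-- free coefficient indices -/
abbrev Idx' := {p : Fin n × (Fin n → ℤ) // p.2 ∈ (A p.1).erase (a0 p.1)}

instance : Finite (Idx A) := by
  classical
  refine Finite.of_injective (fun p : Idx A => ((⟨p.1.1, ⟨p.1.2, p.2⟩⟩ : Σ i, A i))) ?_
  rintro ⟨⟨i, a⟩, h⟩ ⟨⟨i', a'⟩, h'⟩ he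
  simp only [Sigma.mk.injEq] at he
  obtain ⟨rfl, he⟩ := he
  simp only [heq_eq_eq, Subtype.mk.injEq] at he
  subst he; rfl

instance : Finite (Idx' A a0) :=
  Finite.of_injective (fun p : Idx' A a0 => (⟨p.1, Finset.mem_of_mem_erase p.2⟩ : Idx A))
    (fun _ _ h => Subtype.ext (congrArg (fun x : Idx A => x.1) h))

/-- incidence ring -/
abbrev IB := MvPolynomial (Idx' A a0) (LR n)

/-- monomial in the incidence ring -/
noncomputable def xm : Multiplicative (Fin n → ℤ) →* IB A a0 where
  toFun a := MvPolynomial.C (AddMonoidAlgebra.single a.toAdd 1)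
  map_one' := by
    rw [toAdd_one, ← AddMonoidAlgebra.one_def, map_one]
  map_mul' a b := by
    rw [← map_mul, AddMonoidAlgebra.single_mul_single]; simp

/-- monomial as unit -/
noncomputable def xu : Multiplicative (Fin n → ℤ) →* (IB A a0)ˣ := (xm A a0).toHomUnits

lemma xu_mon (a : Fin n → ℤ) :
    mon (fun j => xu A a0 (Multiplicative.ofAdd (Pi.single j 1))) a
      = xu A a0 (Multiplicative.ofAdd a) := by
  rw [mon_map]
  congr 1
  unfold mon
  apply Multiplicative.toAdd.injective
  rw [toAdd_prod]
  ext i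
  simp [Finset.sum_apply, Pi.single_apply]

open Classical in
/-- free coefficients -/
noncomputable def vv (i : Fin n) (a : Fin n → ℤ) : IB A a0 :=
  if h : a ∈ (A i).erase (a0 i) then MvPolynomial.X ⟨(i, a), h⟩ else 0

open Classical in
/-- universal coefficients -/
noncomputable def ww (i : Fin n) (a : Fin n → ℤ) : IB A a0 :=
  if a = a0 i then ngg (∑ b ∈ (A i).erase (a0 i), vv A a0 i b * xm A a0 (Multiplicative.ofAdd (b - a0 i)))
  else vv A a0 i a

lemma ww_sum (ha : ∀ i, a0 i ∈ A i) (i : Fin n) :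
    ∑ a ∈ A i, ww A a0 i a * xm A a0 (Multiplicative.ofAdd a) = 0 := by
  classical
  rw [← Finset.add_sum_erase _ _ (ha i)]
  have h1 : ∑ a ∈ (A i).erase (a0 i), ww A a0 i a * xm A a0 (Multiplicative.ofAdd a)
      = ∑ a ∈ (A i).erase (a0 i), vv A a0 i a * xm A a0 (Multiplicative.ofAdd a) := by
    refine Finset.sum_congr rfl fun a h => ?_
    rw [ww, if_neg (Finset.ne_of_mem_erase h)]
  rw [h1, ww, if_pos rfl]
  rw [ngg_add, Finset.sum_mul]
  refine Finset.sum_congr rfl fun a h => ?_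
  rw [mul_assoc, ← map_mul, ← ofAdd_add, sub_add_cancel]

/-- parameter ring -/
abbrev IS := MvPolynomial (Idx A) ℂ

/-- structure map -/
noncomputable def gg : IS A →ₐ[ℂ] IB A a0 := MvPolynomial.aeval (fun p => ww A a0 p.1.1 p.1.2)

variable {A a0}

/-- point of a homomorphism -/
noncomputable def pt {M : Type} [Field M] (ψ : IB A a0 →+* M) : Fin n → Mˣ :=
  fun j => Units.map (ψ : IB A a0 →* M) (xu A a0 (Multiplicative.ofAdd (Pi.single j 1)))

lemma pt_mon {M : Type} [Field M] (ψ : IB A a0 →+* M) (a : Fin n → ℤ) :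
    ((mon (pt ψ) a : Mˣ) : M) = ψ (xm A a0 (Multiplicative.ofAdd a)) := by
  unfold pt
  rw [mon_map, xu_mon]
  rfl

lemma pt_zero (ha : ∀ i, a0 i ∈ A i) {M : Type} [Field M] (ψ : IB A a0 →+* M) (i : Fin n) :
    ∑ a ∈ A i, ψ (ww A a0 i a) * ((mon (pt ψ) a : Mˣ) : M) = 0 := by
  have := congrArg ψ (ww_sum A a0 ha i)
  simpa only [map_sum, map_mul, map_zero, pt_mon] using this

lemma pt_inj {M : Type} [Field M] (ψ ψ' : IB A a0 →+* M)
    (h : ∀ s, ψ (gg A a0 s) = ψ' (gg A a0 s)) (hp : pt ψ = pt ψ') : ψ = ψ' := by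
  classical
  apply MvPolynomial.ringHom_ext
  · intro r
    have : (ψ.comp MvPolynomial.C) = (ψ'.comp (MvPolynomial.C : LR n →+* IB A a0)) := by
      apply AddMonoidAlgebra.ringHom_ext
      · intro z
        have h1 := h (MvPolynomial.C z)
        have h2 : gg A a0 (MvPolynomial.C z) = MvPolynomial.C (AddMonoidAlgebra.single 0 z) := by
          rw [← MvPolynomial.algebraMap_eq, AlgHom.commutes]
          rfl
        rw [h2] at h1
        exact h1
      · intro a
        have h1 := pt_mon ψ a
        rw [hp, pt_mon] at h1
        exact h1.symm
    exact RingHom.congr_fun this r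
  · rintro ⟨⟨i, a⟩, ha⟩
    have h1 := h (MvPolynomial.X ⟨(i, a), Finset.mem_of_mem_erase ha⟩)
    have h2 : gg A a0 (MvPolynomial.X ⟨(i, a), Finset.mem_of_mem_erase ha⟩)
        = MvPolynomial.X ⟨(i, a), ha⟩ := by
      rw [gg, MvPolynomial.aeval_X, ww, if_neg (Finset.ne_of_mem_erase ha), vv, dif_pos ha]
    rwa [h2] at h1

/-- evaluation at a solution -/
noncomputable def evz (c : Fin n → (Fin n → ℤ) → ℂ) (z : Fin n → ℂˣ) : IB A a0 →ₐ[ℂ] ℂ :=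
  MvPolynomial.aevalTower
    (AddMonoidAlgebra.lift ℂ ℂ (Fin n → ℤ) ((Units.coeHom ℂ).comp
      ({ toFun := fun a => mon z a.toAdd, map_one' := mon_zero z,
         map_mul' := fun a b => mon_add z a.toAdd b.toAdd } : Multiplicative (Fin n → ℤ) →* ℂˣ)))
    (fun p => c p.1.1 p.1.2)

lemma evz_xm (c : Fin n → (Fin n → ℤ) → ℂ) (z : Fin n → ℂˣ) (a : Fin n → ℤ) :
    evz c z (xm A a0 (Multiplicative.ofAdd a)) = (mon z a : ℂˣ) := by
  simp [evz, xm, AddMonoidAlgebra.lift_single]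

lemma evz_vv (c : Fin n → (Fin n → ℤ) → ℂ) (z : Fin n → ℂˣ) (i : Fin n) (a : Fin n → ℤ)
    (h : a ∈ (A i).erase (a0 i)) :
    evz c z (vv A a0 i a) = c i a := by
  classical
  rw [vv, dif_pos (by convert h)]
  simp [evz]

lemma evz_pt (c : Fin n → (Fin n → ℤ) → ℂ) (z : Fin n → ℂˣ) :
    pt (evz c z : IB A a0 →ₐ[ℂ] ℂ).toRingHom = z := by
  ext j
  rw [← mon_single (pt _) j, pt_mon, ← mon_single z j]
  exact evz_xm c z _

lemma evz_ww (ha : ∀ i, a0 i ∈ A i) (c : Fin n → (Fin n → ℤ) → ℂ) (z : Fin n → ℂˣ)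
    (hz : ∀ i, ∑ a ∈ A i, c i a * ((mon z a : ℂˣ) : ℂ) = 0) (i : Fin n) (a : Fin n → ℤ)
    (h : a ∈ A i) :
    evz c z (ww A a0 i a) = c i a := by
  classical
  by_cases h0 : a = a0 i
  · subst h0
    have h1 := hz i
    have h2 := pt_zero ha (evz c z : IB A a0 →ₐ[ℂ] ℂ).toRingHom i
    rw [evz_pt] at h2
    rw [← Finset.add_sum_erase _ _ (ha i)] at h1 h2
    have h3 : ∑ x ∈ (A i).erase (a0 i), (evz c z : IB A a0 →ₐ[ℂ] ℂ).toRingHom (ww A a0 i x) *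
        ((mon z x : ℂˣ) : ℂ) = ∑ x ∈ (A i).erase (a0 i), c i x * ((mon z x : ℂˣ) : ℂ) := by
      refine Finset.sum_congr rfl fun x hx => ?_
      rw [ww, if_neg (Finset.ne_of_mem_erase hx)]
      congr 1
      exact evz_vv c z i x hx
    rw [h3] at h2
    have h4 := h2.trans h1.symm
    exact mul_right_cancel₀ (Units.ne_zero _) (add_right_cancel h4)
  · rw [ww, if_neg h0]
    exact evz_vv c z i a (Finset.mem_erase.2 ⟨h0, h⟩)

end conc

end BKK

namespace BKK

variable {n : ℕ}

lemma isIntegral_sub {k S B : Type} [CommRing k] [CommRing S] [CommRing B] [Algebra k B]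
    [Algebra S B] (C : Subalgebra k B) (hC : ∀ s : S, algebraMap S B s ∈ C) (x : B)
    (hx : IsIntegral S x) : IsIntegral C x := by
  obtain ⟨p, hp, hp2⟩ := hx
  refine ⟨p.map ((algebraMap S B).codRestrict C hC), hp.map _, ?_⟩
  rw [Polynomial.eval₂_map]
  exact hp2

lemma trdeg_ge (A : Fin n → Finset (Fin n → ℤ)) (a0 : Fin n → (Fin n → ℤ)) :
    Cardinal.mk (Idx A) ≤ Algebra.trdeg ℂ (IB A a0) := by
  classical
  have h1 := (algInd_x n).sumElim_comp (MvPolynomial.algebraicIndependent_X (Idx' A a0) (LR n))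
  refine le_trans ?_ h1.cardinalMk_le_trdeg
  refine Cardinal.mk_le_of_injective (f := fun p : Idx A =>
    if h : p.1.2 = a0 p.1.1 then Sum.inr p.1.1
    else Sum.inl ⟨p.1, Finset.mem_erase.2 ⟨h, p.2⟩⟩) ?_
  rintro ⟨⟨i, a⟩, h⟩ ⟨⟨i', a'⟩, h'⟩ he
  dsimp only at he
  split_ifs at he with h1 h2 h2
  · simp only [Sum.inr.injEq] at he
    subst he
    apply Subtype.ext
    simp_all
  · simp only [Sum.inl.injEq, Subtype.mk.injEq] at he
    exact Subtype.ext he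

theorem point_count {A : Fin n → Finset (Fin n → ℤ)} (hA : ∀ i, (A i).Nonempty)
    (c : Fin n → (Fin n → ℤ) → ℂ)
    (hZ : {x : Fin n → ℂˣ | ∀ i, ∑ a ∈ A i, c i a * ((mon x a : ℂˣ) : ℂ) = 0}.Finite)
    {L : Type} [Field L] [Algebra ℂ L] [IsAlgClosed L] (τ : Fin n → (Fin n → ℤ) → L)
    (hτ : AlgebraicIndependent ℂ (fun p : Idx A => τ p.1.1 p.1.2))
    (hW : {x : Fin n → Lˣ | ∀ i, ∑ a ∈ A i, τ i a * ((mon x a : Lˣ) : L) = 0}.Finite) :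
    {x : Fin n → ℂˣ | ∀ i, ∑ a ∈ A i, c i a * ((mon x a : ℂˣ) : ℂ) = 0}.ncard ≤
    {x : Fin n → Lˣ | ∀ i, ∑ a ∈ A i, τ i a * ((mon x a : Lˣ) : L) = 0}.ncard := by
  classical
  set Z := {x : Fin n → ℂˣ | ∀ i, ∑ a ∈ A i, c i a * ((mon x a : ℂˣ) : ℂ) = 0} with hZdef
  set W := {x : Fin n → Lˣ | ∀ i, ∑ a ∈ A i, τ i a * ((mon x a : Lˣ) : L) = 0} with hWdef
  rcases Z.eq_empty_or_nonempty with he | ⟨z0, hz0⟩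
  · simp [he]
  choose a0 ha using hA
  let : Algebra (IS A) (IB A a0) := (gg A a0).toRingHom.toAlgebra
  have hmap : ∀ s : IS A, algebraMap (IS A) (IB A a0) s = gg A a0 s := fun _ => rfl
  have : IsScalarTower ℂ (IS A) (IB A a0) := IsScalarTower.of_algebraMap_eq fun z => by
    rw [hmap, AlgHom.commutes]
  let ev0 : IS A →ₐ[ℂ] ℂ := MvPolynomial.aeval (fun p => c p.1.1 p.1.2)
  have hcong : ∀ φ ∈ Fib ℂ (IS A) (IB A a0) ev0, ∀ i, ∀ a ∈ A i, φ (ww A a0 i a) = c i a := by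
    intro φ hφ i a hi
    have h1 := hφ (MvPolynomial.X ⟨(i, a), hi⟩)
    rw [hmap, gg, MvPolynomial.aeval_X] at h1
    rw [h1]; simp [ev0]
  have hmapsTo : ∀ φ ∈ Fib ℂ (IS A) (IB A a0) ev0, pt φ.toRingHom ∈ Z := by
    intro φ hφ i
    have h1 := pt_zero ha φ.toRingHom i
    rw [← h1]
    refine Finset.sum_congr rfl fun a hi => ?_
    rw [← hcong φ hφ i a hi]; rfl
  have hinj : Set.InjOn (fun φ : IB A a0 →ₐ[ℂ] ℂ => pt φ.toRingHom)
      (Fib ℂ (IS A) (IB A a0) ev0) := by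
    intro φ hφ φ' hφ' h
    have h1 := pt_inj φ.toRingHom φ'.toRingHom (fun s => (hφ s).trans (hφ' s).symm) h
    exact AlgHom.ext fun x => RingHom.congr_fun h1 x
  have hE : (Fib ℂ (IS A) (IB A a0) ev0).Finite :=
    Set.Finite.of_injOn (fun φ hφ => hmapsTo φ hφ) hinj hZ
  have hevz : ∀ z ∈ Z, evz c z ∈ Fib ℂ (IS A) (IB A a0) ev0 := by
    intro z hz s
    rw [hmap]
    have : (evz c z).comp (gg A a0) = ev0 := by
      apply MvPolynomial.algHom_ext
      rintro ⟨⟨i, a⟩, hi⟩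
      simp only [AlgHom.comp_apply, gg, MvPolynomial.aeval_X, ev0]
      exact evz_ww ha c z hz i a hi
    rw [← this]; rfl
  have hcard1 : Z.ncard ≤ (Fib ℂ (IS A) (IB A a0) ev0).ncard := by
    refine Set.ncard_le_ncard_of_injOn (fun z => evz c z) hevz ?_ hE
    intro z hz z' hz' h
    rw [← evz_pt (A := A) (a0 := a0) c z, ← evz_pt (A := A) (a0 := a0) c z']
    exact congrArg (fun φ : IB A a0 →ₐ[ℂ] ℂ => pt φ.toRingHom) h
  -- injectivity
  have hfaith : FaithfulSMul (IS A) (IB A a0) := by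
    obtain ⟨r, hr, hri, hx⟩ := zmt ev0 hE _ (hevz z0 hz0)
    have hr0 : r ≠ 0 := by rintro rfl; simp at hr
    let C := Algebra.adjoin ℂ (Set.range (fun p : Idx A => ww A a0 p.1.1 p.1.2))
    have hC : ∀ s : IS A, algebraMap (IS A) (IB A a0) s ∈ C := by
      intro s
      have : C = (gg A a0).range := by
        exact Algebra.adjoin_range_eq_range_aeval ℂ _
      rw [this]
      exact ⟨s, rfl⟩
    have halg : Algebra.IsAlgebraic C (IB A a0) := alg_of_zmt r hr0 (isIntegral_sub C hC _ hri)
      (fun x => (hx x).imp fun m hm => isIntegral_sub C hC _ hm)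
    have htr := Algebra.IsAlgebraic.isTranscendenceBasis_of_le_trdeg_of_finite ℂ
      (fun p : Idx A => ww A a0 p.1.1 p.1.2) (trdeg_ge A a0)
    rw [faithfulSMul_iff_algebraMap_injective]
    exact htr.1
  have hτ' : Function.Injective
      (MvPolynomial.aeval (fun p : Idx A => τ p.1.1 p.1.2) : IS A →ₐ[ℂ] L).toRingHom := hτ
  obtain ⟨T, hT, hTc⟩ := lift_count ev0 hE
    (MvPolynomial.aeval (fun p : Idx A => τ p.1.1 p.1.2) : IS A →ₐ[ℂ] L).toRingHom hτ'
  refine hcard1.trans (hTc.trans ?_)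
  rw [← Set.ncard_coe_finset]
  refine Set.ncard_le_ncard_of_injOn (fun ψ => pt ψ) ?_ ?_ hW
  · intro ψ hψ i
    rw [← pt_zero ha ψ i]
    refine Finset.sum_congr rfl fun a hi => ?_
    have h1 := hT ψ hψ (MvPolynomial.X ⟨(i, a), hi⟩)
    rw [hmap, gg, MvPolynomial.aeval_X] at h1
    rw [h1]; simp
  · intro ψ hψ ψ' hψ' h
    exact pt_inj ψ ψ' (fun s => (hT ψ hψ s).trans (hT ψ' hψ' s).symm) h

end BKK

/-- **Bernstein's bound (without multiplicities).** Let `f₁, …, f_n` be nonzero Laurent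
polynomials in `n` variables over `ℂ` with finite common zero set `Z ⊆ (ℂˣ)^n`, and let `P_i` be
the Newton polytope of `f_i`. Then `|Z|` is at most the mixed volume
`MV(P₁, …, P_n) = Σ_{S ⊆ {1,…,n}} (−1)^{n−|S|} vol_n(Σ_{i∈S} P_i)`. -/
theorem bernstein_bound
    (n : ℕ) (f : Fin n → ((Fin n → ℤ) →₀ ℂ)) (hf : ∀ i, f i ≠ 0)
    (Z : Set (Fin n → ℂˣ))
    (hZ : Z = {x | ∀ i, ∑ a ∈ (f i).support, f i a * ∏ j, (x j : ℂ) ^ a j = 0})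
    (hZfin : Z.Finite)
    (P : Fin n → Set (Fin n → ℝ))
    (hP : ∀ i, P i = convexHull ℝ
        ((fun a : Fin n → ℤ => fun j => (a j : ℝ)) '' ((f i).support : Set (Fin n → ℤ)))) :
    (Z.ncard : ℝ)
      ≤ ∑ S : Finset (Fin n), (-1 : ℝ) ^ (n - S.card) * (volume (∑ i ∈ S, P i)).toReal := by
  classical
  obtain ⟨ω, hω⟩ := BKK.exists_gen n
  obtain ⟨L, iF, iA, iC, V, t, hV, ht, hind⟩ := BKK.exists_valued
  have hchar : CharZero (IsLocalRing.ResidueField V) := by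
    let φ : ℂ →+* V := (algebraMap ℂ L).codRestrict V.toSubring hV
    exact charZero_of_injective_ringHom ((IsLocalRing.residue V).comp φ).injective
  have hA : ∀ i, ((f i).support).Nonempty := fun i => Finsupp.support_nonempty_iff.2 (hf i)
  obtain ⟨hfin, hle⟩ := BKK.count_L V t (A := fun i => (f i).support) hA hω ht
  have hZ' : Z = {x : Fin n → ℂˣ | ∀ i, ∑ a ∈ (f i).support,
      f i a * ((BKK.mon x a : ℂˣ) : ℂ) = 0} := by
    rw [hZ]
    ext x
    simp [BKK.mon]
  have hτ : AlgebraicIndependent ℂ (fun p : BKK.Idx (fun i => (f i).support) =>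
      (BKK.tt t (ω p.1.1 p.1.2) : L)) := by
    refine hind _ (fun p : BKK.Idx (fun i => (f i).support) => ω p.1.1 p.1.2) ?_
    exact LinearIndependent.comp hω (fun p : BKK.Idx (fun i => (f i).support) => p.1)
      Subtype.val_injective
  have hmain := BKK.point_count (A := fun i => (f i).support) hA (fun i a => f i a)
    (by rw [← hZ']; exact hZfin) (fun i a => (BKK.tt t (ω i a) : L)) hτ hfin
  rw [← hZ'] at hmain
  have hP' : P = fun i => convexHull ℝ (BKK.emb '' ((f i).support : Set (Fin n → ℤ))) :=
    funext hP
  subst hP'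
  exact le_trans (by exact_mod_cast hmain) hle
end
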